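/- arXiv:2402.13691 — 2 statements merged into one kernel-verified Lean document; each statement's English description precedes it below -/
import Mathlib

section
/- Let ν ∈ (0,1) and let l_ν(t,x) = t^{-ν} W_{-ν, 1-ν}(-x t^{-ν}) for t > 0, x ≥ 0, where W is the Wright function. Then for every fixed x ≥ 0, the t-Laplace transform satisfies ∫_0^∞ e^{-μt} l_ν(t,x) dt = μ^{ν-1} e^{-μ^ν x} for all μ > 0. -/
open MeasureTheory Set

/-- The Wright function `W_{α,β}(x) = Σ_{k≥0} x^k / (k! Γ(αk+β))` (real arguments). -/
noncomputable def wrightFn (α β x : ℝ) : ℝ :=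
  ∑' k : ℕ, x ^ k / (Nat.factorial k * Real.Gamma (α * k + β))

/-- The density of the inverse of a stable subordinator of order `ν`. -/
noncomputable def invStableDensity (ν t x : ℝ) : ℝ :=
  t ^ (-ν) * wrightFn (-ν) (1 - ν) (-(x * t ^ (-ν)))

/-- The Laplace transform of a power, at complex argument. -/
lemma aux_complex_gamma (a : ℝ) (ha : 0 < a) (w : ℂ) (hw : 0 < w.re) :
    ∫ r in Ioi (0:ℝ), ((r ^ (a - 1) : ℝ) : ℂ) * Complex.exp (-(w * r)) =
      Complex.exp (-(a * Complex.log w)) * (Real.Gamma a : ℂ) := by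
  set U : Set ℂ := {z | 0 < z.re} with hU
  have hUo : IsOpen U := isOpen_lt continuous_const Complex.continuous_re
  have hUc : IsPreconnected U := (convex_halfSpace_re_gt 0).isPreconnected
  have hint : ∀ s : ℝ, -1 < s → ∀ b : ℝ, 0 < b →
      IntegrableOn (fun r : ℝ => r ^ s * Real.exp (-b * r)) (Ioi 0) := by
    intro s hs b hb
    have := integrableOn_rpow_mul_exp_neg_mul_rpow hs one_pos hb
    simpa only [Real.rpow_one] using this
  have hf : DifferentiableOn ℂ
      (fun z : ℂ => ∫ r in Ioi (0:ℝ), ((r ^ (a - 1) : ℝ) : ℂ) * Complex.exp (-(z * r))) U := by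
    intro z hz
    have hz' : 0 < z.re := hz
    refine DifferentiableAt.differentiableWithinAt ?_
    have hs : {y : ℂ | z.re / 2 < y.re} ∈ nhds z :=
      (isOpen_lt continuous_const Complex.continuous_re).mem_nhds
        (by show z.re / 2 < z.re; linarith)
    refine (hasDerivAt_integral_of_dominated_loc_of_deriv_le (μ := volume.restrict (Ioi (0:ℝ)))
      (F := fun (z : ℂ) (r : ℝ) => ((r ^ (a - 1) : ℝ) : ℂ) * Complex.exp (-(z * r)))
      (F' := fun (z : ℂ) (r : ℝ) => ((r ^ (a - 1) : ℝ) : ℂ) * (Complex.exp (-(z * r)) * (-r)))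
      (bound := fun r => r ^ a * Real.exp (-(z.re / 2) * r))
      hs ?_ ?_ ?_ ?_ ?_ ?_).2.differentiableAt
    · refine Filter.Eventually.of_forall fun y => Measurable.aestronglyMeasurable ?_
      fun_prop
    · refine Integrable.mono' (hint (a - 1) (by linarith) z.re hz')
        (Measurable.aestronglyMeasurable (by fun_prop)) ?_
      refine (ae_restrict_iff' measurableSet_Ioi).mpr (ae_of_all _ fun r hr => ?_)
      have hr' : (0:ℝ) < r := hr
      rw [norm_mul, Complex.norm_real, Real.norm_of_nonneg (by positivity), Complex.norm_exp]
      simp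
    · exact Measurable.aestronglyMeasurable (by fun_prop)
    · refine (ae_restrict_iff' measurableSet_Ioi).mpr (ae_of_all _ fun r hr y hy => ?_)
      have hr' : (0:ℝ) < r := hr
      have hy' : z.re / 2 < y.re := hy
      rw [norm_mul, norm_mul, norm_neg, Complex.norm_real, Complex.norm_real,
        Real.norm_of_nonneg (by positivity), Real.norm_of_nonneg hr'.le, Complex.norm_exp]
      have e : r ^ a = r ^ (a - 1) * r := by
        rw [Real.rpow_sub_one hr'.ne']; field_simp
      have e2 : (-(y * r)).re = -y.re * r := by simp
      have e3 : Real.exp (-y.re * r) ≤ Real.exp (-(z.re / 2) * r) := by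
        rw [Real.exp_le_exp]; nlinarith
      rw [e, e2]
      calc _ ≤ r ^ (a - 1) * (Real.exp (-(z.re / 2) * r) * r) := by gcongr
        _ = _ := by ring
    · exact hint a (by linarith) _ (by linarith)
    · refine ae_of_all _ fun r y _ => ?_
      refine HasDerivAt.const_mul _ ?_
      have h : HasDerivAt (fun y : ℂ => -(y * (r:ℂ))) (-(1 * (r:ℂ))) y :=
        ((hasDerivAt_id y).mul_const (r:ℂ)).neg
      simpa using h.cexp
  have hg : DifferentiableOn ℂ
      (fun z : ℂ => Complex.exp (-(a * Complex.log z)) * (Real.Gamma a : ℂ)) U := by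
    intro z hz
    have hz' : 0 < z.re := hz
    have : z ∈ Complex.slitPlane := Or.inl hz'
    refine DifferentiableAt.differentiableWithinAt ?_
    fun_prop (disch := assumption)
  have h1 : (1:ℂ) ∈ U := by simp [hU]
  refine AnalyticOnNhd.eqOn_of_preconnected_of_frequently_eq (hf.analyticOnNhd hUo)
    (hg.analyticOnNhd hUo) hUc h1 ?_ hw
  have hmap : Filter.Tendsto (fun y : ℝ => (y : ℂ)) (nhdsWithin 1 {1}ᶜ) (nhdsWithin (1:ℂ) {1}ᶜ) := by
    refine tendsto_nhdsWithin_iff.mpr ⟨?_, ?_⟩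
    · have := (Complex.continuous_ofReal.tendsto 1)
      simp only [Complex.ofReal_one] at this
      exact this.mono_left nhdsWithin_le_nhds
    · filter_upwards [self_mem_nhdsWithin] with y hy
      simpa using hy
  refine hmap.frequently (Filter.Eventually.frequently ?_)
  filter_upwards [mem_nhdsWithin_of_mem_nhds (lt_mem_nhds one_pos)] with y hy
  have key := Real.integral_rpow_mul_exp_neg_mul_Ioi ha hy
  have e : ∀ r : ℝ, ((r ^ (a - 1) : ℝ) : ℂ) * Complex.exp (-((y:ℂ) * r)) =
      ((r ^ (a - 1) * Real.exp (-(y * r)) : ℝ) : ℂ) := by intro r; push_cast; rfl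
  simp_rw [e]
  rw [integral_complex_ofReal, key, ← Complex.ofReal_log hy.le]
  rw [one_div, Real.inv_rpow hy.le, ← Real.rpow_neg hy.le, Real.rpow_def_of_pos hy]
  push_cast
  congr 2
  ring

/-- The reflection formula in a form valid at the poles as well. -/
lemma aux_reflection (a : ℝ) (ha : 0 < a) :
    Real.Gamma a * Real.sin (Real.pi * a) = Real.pi / Real.Gamma (1 - a) := by
  have h := Real.Gamma_mul_Gamma_one_sub a
  have hG : Real.Gamma a ≠ 0 := (Real.Gamma_pos_of_pos ha).ne'
  by_cases hs : Real.sin (Real.pi * a) = 0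
  · rw [hs, div_zero] at h
    have : Real.Gamma (1 - a) = 0 := by
      rcases mul_eq_zero.mp h with h | h
      · exact absurd h hG
      · exact h
    rw [hs, this]; simp
  · have h1 : Real.Gamma (1 - a) ≠ 0 := by
      intro h0
      rw [h0, mul_zero] at h
      exact (div_ne_zero Real.pi_ne_zero hs) h.symm
    rw [eq_div_iff h1, mul_right_comm, h]
    field_simp

/-- Gamma integral along a ray. -/
lemma aux_ray_gamma (θ a t : ℝ) (h1 : Real.pi / 2 < θ) (h2 : θ < Real.pi) (ha : 0 < a)
    (ht : 0 < t) :
    (Complex.exp (θ * a * Complex.I) *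
      ∫ r in Ioi (0:ℝ), Complex.exp (t * r * Complex.exp (θ * Complex.I)) *
        ((r ^ (a - 1) : ℝ) : ℂ)).im = t ^ (-a) * (Real.pi / Real.Gamma (1 - a)) := by
  have hc : Real.cos θ < 0 := Real.cos_neg_of_pi_div_two_lt_of_lt h1 (by linarith [Real.pi_pos])
  have hre : 0 < (-(t * Complex.exp (θ * Complex.I))).re := by
    rw [Complex.neg_re, Complex.re_ofReal_mul, Complex.exp_ofReal_mul_I_re]
    nlinarith
  have key := aux_complex_gamma a ha _ hre
  have e1 : ∫ r in Ioi (0:ℝ), Complex.exp (t * r * Complex.exp (θ * Complex.I)) *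
        ((r ^ (a - 1) : ℝ) : ℂ) = ∫ (r : ℝ) in Ioi 0, ((r ^ (a - 1) : ℝ) : ℂ) *
          Complex.exp (-(-(t * Complex.exp (θ * Complex.I)) * r)) := by
    refine setIntegral_congr_fun measurableSet_Ioi (fun r hr => ?_)
    rw [mul_comm]
    congr 2
    ring
  rw [e1, key]
  have e2 : (-(t * Complex.exp (θ * Complex.I))) =
      (t : ℂ) * Complex.exp ((θ - Real.pi : ℝ) * Complex.I) := by
    push_cast
    rw [sub_mul, Complex.exp_sub, Complex.exp_pi_mul_I]
    ring
  have e3 : Complex.exp (-(a * Complex.log (-(t * Complex.exp (θ * Complex.I))))) =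
      ((t ^ (-a) : ℝ) : ℂ) * Complex.exp ((Real.pi - θ : ℝ) * a * Complex.I) := by
    rw [e2, Complex.log_ofReal_mul ht (Complex.exp_ne_zero _),
      Complex.log_exp (by simp; linarith [Real.pi_pos]) (by simp; linarith [Real.pi_pos]),
      Real.rpow_def_of_pos ht, Complex.ofReal_exp, ← Complex.exp_add]
    congr 1
    push_cast
    ring
  rw [e3, ← aux_reflection a ha]
  have e4 : Complex.exp (θ * a * Complex.I) * (((t ^ (-a) : ℝ) : ℂ) *
      Complex.exp ((Real.pi - θ : ℝ) * a * Complex.I) * (Real.Gamma a : ℂ)) =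
      ((t ^ (-a) * Real.Gamma a : ℝ) : ℂ) * Complex.exp ((Real.pi * a : ℝ) * Complex.I) := by
    have : Complex.exp ((Real.pi * a : ℝ) * Complex.I) = Complex.exp (θ * a * Complex.I) *
      Complex.exp ((Real.pi - θ : ℝ) * a * Complex.I) := by
      rw [← Complex.exp_add]
      congr 1
      push_cast
      ring
    rw [this]
    push_cast
    ring
  rw [e4, Complex.im_ofReal_mul, Complex.exp_ofReal_mul_I_im]
  ring

/-- Young type bound. -/
lemma aux_young (ν x ε : ℝ) (h0 : 0 < ν) (h1 : ν < 1) (hx : 0 ≤ x) (hε : 0 < ε) :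
    ∃ C : ℝ, ∀ r : ℝ, 0 < r → x * r ^ ν ≤ ε * r + C := by
  set A := (x / ε) ^ (1 / (1 - ν)) with hA
  have hA0 : 0 ≤ A := by positivity
  refine ⟨ε * A, fun r hr => ?_⟩
  have h := Real.geom_mean_le_arith_mean2_weighted h0.le (by linarith : 0 ≤ 1 - ν) hr.le hA0
    (by ring)
  have hAp : A ^ (1 - ν) = x / ε := by
    rw [hA, ← Real.rpow_mul (by positivity), one_div, inv_mul_cancel₀ (by linarith), Real.rpow_one]
  rw [hAp] at h
  have h3 : x * r ^ ν = ε * (r ^ ν * (x / ε)) := by field_simp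
  rw [h3]
  have : ν * r + (1 - ν) * A ≤ r + A := by nlinarith
  nlinarith

/-- The kernel on the ray. -/
noncomputable def auxK (ν θ x r : ℝ) : ℂ :=
  ((r ^ (ν - 1) : ℝ) : ℂ) * Complex.exp (θ * ν * Complex.I) *
    Complex.exp (-(x * r ^ ν : ℝ) * Complex.exp (θ * ν * Complex.I))

lemma auxK_meas (ν θ x : ℝ) : Measurable (auxK ν θ x) := by
  unfold auxK
  fun_prop

lemma auxK_norm (ν θ x r : ℝ) (hx : 0 ≤ x) (hr : 0 < r) (hc : 0 ≤ Real.cos (θ * ν)) :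
    ‖auxK ν θ x r‖ ≤ r ^ (ν - 1) := by
  unfold auxK
  have e : (θ * ν * Complex.I : ℂ) = ((θ * ν : ℝ) : ℂ) * Complex.I := by push_cast; ring
  rw [norm_mul, norm_mul, Complex.norm_real, e, Complex.norm_exp_ofReal_mul_I, Complex.norm_exp,
    mul_one, Real.norm_of_nonneg (by positivity), ← Complex.ofReal_neg, Complex.re_ofReal_mul,
    Complex.exp_ofReal_mul_I_re]
  refine mul_le_of_le_one_right (by positivity) ?_
  rw [Real.exp_le_one_iff]
  have : 0 ≤ x * r ^ ν := by positivity
  nlinarith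

lemma aux_norm_exp_ray (θ t r : ℝ) :
    ‖Complex.exp (t * r * Complex.exp (θ * Complex.I))‖ = Real.exp (t * r * Real.cos θ) := by
  rw [Complex.norm_exp, ← Complex.ofReal_mul, Complex.re_ofReal_mul, Complex.exp_ofReal_mul_I_re]

lemma aux_term (ν θ x t r : ℝ) (hr : 0 < r) (k : ℕ) :
    Complex.exp (t * r * Complex.exp (θ * Complex.I)) * (((r ^ (ν - 1) : ℝ) : ℂ) *
      Complex.exp (θ * ν * Complex.I) *
      ((-(x * r ^ ν : ℝ) * Complex.exp (θ * ν * Complex.I)) ^ k / (Nat.factorial k : ℂ))) =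
    (((-x) ^ k / Nat.factorial k : ℝ) : ℂ) * (Complex.exp (θ * (ν * (k + 1) : ℝ) * Complex.I) *
      (Complex.exp (t * r * Complex.exp (θ * Complex.I)) *
        ((r ^ (ν * (k + 1) - 1) : ℝ) : ℂ))) := by
  have e1 : r ^ (ν * (k + 1) - 1) = r ^ (ν - 1) * (r ^ ν) ^ k := by
    rw [← Real.rpow_natCast (r ^ ν), ← Real.rpow_mul hr.le, ← Real.rpow_add hr]
    congr 1; ring
  have e2 : Complex.exp (θ * (ν * (k + 1) : ℝ) * Complex.I) = Complex.exp (θ * ν * Complex.I) *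
      Complex.exp (θ * ν * Complex.I) ^ k := by
    rw [← Complex.exp_nat_mul, ← Complex.exp_add]
    congr 1; push_cast; ring
  rw [e1, e2, mul_pow]
  push_cast
  rw [← neg_mul, mul_pow]
  ring

/-- Step A: integral representation of the density. -/
lemma aux_repr (ν θ x t : ℝ) (hν0 : 0 < ν) (hν1 : ν < 1) (h1 : Real.pi / 2 < θ)
    (h2 : θ < Real.pi) (hx : 0 ≤ x) (ht : 0 < t) :
    Real.pi * invStableDensity ν t x =
      (∫ r in Ioi (0:ℝ), Complex.exp (t * r * Complex.exp (θ * Complex.I)) * auxK ν θ x r).im := by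
  have hc : Real.cos θ < 0 := Real.cos_neg_of_pi_div_two_lt_of_lt h1 (by linarith [Real.pi_pos])
  set F : ℕ → ℝ → ℂ := fun k r => Complex.exp (t * r * Complex.exp (θ * Complex.I)) *
      (((r ^ (ν - 1) : ℝ) : ℂ) * Complex.exp (θ * ν * Complex.I) *
      ((-(x * r ^ ν : ℝ) * Complex.exp (θ * ν * Complex.I)) ^ k / (Nat.factorial k : ℂ))) with hF
  set B : ℕ → ℝ → ℝ := fun k r => Real.exp (t * r * Real.cos θ) * r ^ (ν - 1) *
      ((x * r ^ ν) ^ k / (Nat.factorial k : ℝ)) with hB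
  have hBsum : ∀ r, HasSum (fun k => B k r)
      (Real.exp (t * r * Real.cos θ) * r ^ (ν - 1) * Real.exp (x * r ^ ν)) := by
    intro r
    have := NormedSpace.expSeries_div_hasSum_exp (x * r ^ ν)
    rw [← Real.exp_eq_exp_ℝ] at this
    exact this.mul_left _
  have hint : IntegrableOn (fun r => Real.exp (t * r * Real.cos θ) * r ^ (ν - 1) *
      Real.exp (x * r ^ ν)) (Ioi 0) := by
    have hε : 0 < t * (-Real.cos θ) / 2 := by
      have : 0 < -Real.cos θ := by linarith
      positivity
    obtain ⟨C, hC⟩ := aux_young ν x _ hν0 hν1 hx hε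
    have hg := (integrableOn_rpow_mul_exp_neg_mul_rpow (s := ν - 1) (by linarith) one_pos
      hε).const_mul (Real.exp C)
    refine Integrable.mono' hg (by fun_prop) ?_
    refine (ae_restrict_iff' measurableSet_Ioi).mpr (ae_of_all _ fun r hr => ?_)
    have hr' : (0:ℝ) < r := hr
    rw [Real.norm_of_nonneg (by positivity), Real.rpow_one]
    have : Real.exp (t * r * Real.cos θ) * Real.exp (x * r ^ ν) ≤
      Real.exp C * Real.exp (-(t * -Real.cos θ / 2) * r) := by
      rw [← Real.exp_add, ← Real.exp_add, Real.exp_le_exp]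
      nlinarith [hC r hr']
    calc _ = r ^ (ν - 1) * (Real.exp (t * r * Real.cos θ) * Real.exp (x * r ^ ν)) := by ring
      _ ≤ r ^ (ν - 1) * (Real.exp C * Real.exp (-(t * -Real.cos θ / 2) * r)) := by gcongr
      _ = _ := by ring
  have hmain : HasSum (fun k => ∫ r in Ioi (0:ℝ), F k r)
      (∫ r in Ioi (0:ℝ), Complex.exp (t * r * Complex.exp (θ * Complex.I)) * auxK ν θ x r) := by
    refine hasSum_integral_of_dominated_convergence B (fun k => ?_) (fun k => ?_) ?_ ?_ ?_
    · apply Measurable.aestronglyMeasurable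
      simp only [hF]
      fun_prop
    · refine (ae_restrict_iff' measurableSet_Ioi).mpr (ae_of_all _ fun r hr => ?_)
      have hr' : (0:ℝ) < r := hr
      simp only [hF, hB]
      have e : (θ * ν * Complex.I : ℂ) = ((θ * ν : ℝ) : ℂ) * Complex.I := by push_cast; ring
      rw [norm_mul, norm_mul, norm_mul, aux_norm_exp_ray, norm_div, norm_pow, norm_mul, norm_neg,
        Complex.norm_real, Complex.norm_real, e, Complex.norm_exp_ofReal_mul_I,
        Real.norm_of_nonneg (by positivity), Real.norm_of_nonneg (by positivity),
        Complex.norm_natCast]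
      apply le_of_eq; ring
    · exact ae_of_all _ fun r => (hBsum r).summable
    · simp_rw [fun r => (hBsum r).tsum_eq]
      exact hint
    · refine ae_of_all _ fun r => ?_
      have := NormedSpace.expSeries_div_hasSum_exp
        (-(x * r ^ ν : ℝ) * Complex.exp (θ * ν * Complex.I))
      rw [← Complex.exp_eq_exp_ℂ] at this
      exact (this.mul_left _).mul_left _
  have him := Complex.hasSum_im hmain
  have hterm : ∀ k : ℕ, (∫ r in Ioi (0:ℝ), F k r).im = Real.pi * (t ^ (-ν) *
      ((-(x * t ^ (-ν))) ^ k / (Nat.factorial k * Real.Gamma (-ν * k + (1 - ν))))) := by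
    intro k
    have e1 : ∫ r in Ioi (0:ℝ), F k r = (((-x) ^ k / Nat.factorial k : ℝ) : ℂ) *
        (Complex.exp (θ * (ν * (k + 1) : ℝ) * Complex.I) *
        ∫ r in Ioi (0:ℝ), (Complex.exp (t * r * Complex.exp (θ * Complex.I)) *
          ((r ^ (ν * (k + 1) - 1) : ℝ) : ℂ))) := by
      rw [← integral_const_mul, ← integral_const_mul]
      exact setIntegral_congr_fun measurableSet_Ioi (fun r hr => aux_term ν θ x t r hr k)
    rw [e1, Complex.im_ofReal_mul, aux_ray_gamma θ _ t h1 h2 (by positivity) ht]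
    have e2 : t ^ (-(ν * (k + 1))) = t ^ (-ν) * (t ^ (-ν)) ^ k := by
      rw [← Real.rpow_natCast (t ^ (-ν)), ← Real.rpow_mul ht.le, ← Real.rpow_add ht]
      congr 1; ring
    have e3 : 1 - ν * (k + 1) = -ν * k + (1 - ν) := by ring
    rw [e2, e3, ← neg_mul, mul_pow]
    simp only [div_eq_mul_inv, mul_inv]
    ring
  simp_rw [hterm] at him
  rw [← him.tsum_eq, tsum_mul_left, tsum_mul_left]
  rfl

lemma aux_int1 (ν μ d : ℝ) (hν0 : 0 < ν) (hν1 : ν < 1) (hμ : 0 < μ) (hd : 0 < d) :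
    IntegrableOn (fun r : ℝ => r ^ (ν - 1) * (1 / (μ + d * r))) (Ioi 0) := by
  rw [← Ioc_union_Ioi_eq_Ioi zero_le_one]
  refine IntegrableOn.union ?_ ?_
  · have h : IntegrableOn (fun r : ℝ => r ^ (ν - 1)) (Ioc 0 1) :=
      (intervalIntegrable_iff_integrableOn_Ioc_of_le zero_le_one).mp
        (intervalIntegral.intervalIntegrable_rpow' (by linarith))
    refine Integrable.mono' (h.mul_const (1 / μ)) (Measurable.aestronglyMeasurable (by fun_prop)) ?_
    refine (ae_restrict_iff' measurableSet_Ioc).mpr (ae_of_all _ fun r hr => ?_)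
    have hr' : (0:ℝ) < r := hr.1
    rw [Real.norm_of_nonneg (by positivity)]
    gcongr
    nlinarith
  · have h := (integrableOn_Ioi_rpow_of_lt (a := ν - 2) (by linarith) one_pos)
    refine Integrable.mono' (h.mul_const (1 / d)) (Measurable.aestronglyMeasurable (by fun_prop)) ?_
    refine (ae_restrict_iff' measurableSet_Ioi).mpr (ae_of_all _ fun r hr => ?_)
    have hr' : (0:ℝ) < r := lt_trans one_pos hr
    rw [Real.norm_of_nonneg (by positivity)]
    have e : r ^ (ν - 2) * (1 / d) = r ^ (ν - 1) * (1 / (d * r)) := by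
      rw [show ν - 2 = ν - 1 - 1 by ring, Real.rpow_sub_one hr'.ne']; field_simp
    rw [e]
    gcongr
    linarith

lemma aux_den (θ μ r : ℝ) :
    (μ - r * Complex.exp (θ * Complex.I)).re = μ + (-Real.cos θ) * r := by
  rw [Complex.sub_re, Complex.ofReal_re, Complex.re_ofReal_mul, Complex.exp_ofReal_mul_I_re]
  ring

lemma aux_quot_int (ν θ x μ : ℝ) (hν0 : 0 < ν) (hν1 : ν < 1) (hd : 0 < -Real.cos θ)
    (hc : 0 ≤ Real.cos (θ * ν)) (hx : 0 ≤ x) (hμ : 0 < μ) :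
    IntegrableOn (fun r : ℝ => auxK ν θ x r / (μ - r * Complex.exp (θ * Complex.I))) (Ioi 0) := by
  have hm := auxK_meas ν θ x
  refine Integrable.mono' (aux_int1 ν μ _ hν0 hν1 hμ hd)
    (Measurable.aestronglyMeasurable (by fun_prop)) ?_
  refine (ae_restrict_iff' measurableSet_Ioi).mpr (ae_of_all _ fun r hr => ?_)
  have hr' : (0:ℝ) < r := hr
  rw [norm_div, div_eq_mul_one_div]
  have h1 := auxK_norm ν θ x r hx hr' hc
  have h2 : μ + (-Real.cos θ) * r ≤ ‖(μ - r * Complex.exp (θ * Complex.I) : ℂ)‖ := by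
    rw [← aux_den]; exact Complex.re_le_norm _
  gcongr

lemma aux_prod (ν θ x μ : ℝ) (hν0 : 0 < ν) (hν1 : ν < 1) (hd : 0 < -Real.cos θ)
    (hc : 0 ≤ Real.cos (θ * ν)) (hx : 0 ≤ x) (hμ : 0 < μ) :
    Integrable (Function.uncurry fun (t r : ℝ) => ((Real.exp (-μ * t) : ℝ) : ℂ) *
      (Complex.exp (t * r * Complex.exp (θ * Complex.I)) * auxK ν θ x r))
      ((volume.restrict (Ioi (0:ℝ))).prod (volume.restrict (Ioi (0:ℝ)))) := by
  have hm := auxK_meas ν θ x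
  set g : ℝ × ℝ → ℝ := fun p => Real.exp (-(μ + (-Real.cos θ) * p.2) * p.1) * p.2 ^ (ν - 1) with hg
  have hgm : Measurable g := by simp only [hg]; fun_prop
  have hgi : Integrable g ((volume.restrict (Ioi (0:ℝ))).prod (volume.restrict (Ioi (0:ℝ)))) := by
    rw [integrable_prod_iff' hgm.aestronglyMeasurable]
    constructor
    · refine (ae_restrict_iff' measurableSet_Ioi).mpr (ae_of_all _ fun r hr => ?_)
      have hr' : (0:ℝ) < r := hr
      have h0 : -(μ + (-Real.cos θ) * r) < 0 := by nlinarith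
      exact (integrableOn_exp_mul_Ioi h0 0).mul_const (r ^ (ν - 1))
    · refine (aux_int1 ν μ _ hν0 hν1 hμ hd).congr ?_
      refine (ae_restrict_iff' measurableSet_Ioi).mpr (ae_of_all _ fun r hr => ?_)
      have hr' : (0:ℝ) < r := hr
      have h0 : -(μ + (-Real.cos θ) * r) < 0 := by nlinarith
      have e : ∀ t : ℝ, ‖g (t, r)‖ =
          Real.exp (-(μ + (-Real.cos θ) * r) * t) * r ^ (ν - 1) := by
        intro t
        simp only [hg]
        exact Real.norm_of_nonneg (by positivity)
      simp_rw [e]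
      rw [integral_mul_const, integral_exp_mul_Ioi h0, mul_zero, Real.exp_zero, neg_div_neg_eq,
        mul_comm]
  have hmm : Measurable (Function.uncurry fun (t r : ℝ) => ((Real.exp (-μ * t) : ℝ) : ℂ) *
      (Complex.exp (t * r * Complex.exp (θ * Complex.I)) * auxK ν θ x r)) := by
    unfold Function.uncurry
    fun_prop
  refine Integrable.mono' hgi hmm.aestronglyMeasurable ?_
  rw [Measure.prod_restrict]
  refine (ae_restrict_iff' (measurableSet_Ioi.prod measurableSet_Ioi)).mpr
    (ae_of_all _ fun p hp => ?_)
  obtain ⟨t, r⟩ := p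
  have ht' : (0:ℝ) < t := hp.1
  have hr' : (0:ℝ) < r := hp.2
  simp only [Function.uncurry, hg]
  rw [norm_mul, norm_mul, aux_norm_exp_ray, Complex.norm_real,
    Real.norm_of_nonneg (Real.exp_pos _).le, ← mul_assoc, ← Real.exp_add]
  have h1 := auxK_norm ν θ x r hx hr' hc
  have e : -μ * t + t * r * Real.cos θ = -(μ + (-Real.cos θ) * r) * t := by ring
  rw [e]
  gcongr

/-- Step B: the Laplace transform as an integral along the ray. -/
lemma aux_laplace (ν θ x μ : ℝ) (hν0 : 0 < ν) (hν1 : ν < 1) (h1 : Real.pi / 2 < θ)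
    (h2 : θ < Real.pi) (hc : 0 ≤ Real.cos (θ * ν)) (hx : 0 ≤ x) (hμ : 0 < μ) :
    Real.pi * ∫ t in Ioi (0:ℝ), Real.exp (-μ * t) * invStableDensity ν t x =
      (∫ r in Ioi (0:ℝ), auxK ν θ x r / (μ - r * Complex.exp (θ * Complex.I))).im := by
  have hd : 0 < -Real.cos θ := by
    have := Real.cos_neg_of_pi_div_two_lt_of_lt h1 (by linarith [Real.pi_pos])
    linarith
  have hp := aux_prod ν θ x μ hν0 hν1 hd hc hx hμ
  have hsw := integral_integral_swap hp
  have hout := hp.integral_prod_left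
  have e1 : ∫ r in Ioi (0:ℝ), ∫ t in Ioi (0:ℝ), ((Real.exp (-μ * t) : ℝ) : ℂ) *
      (Complex.exp (t * r * Complex.exp (θ * Complex.I)) * auxK ν θ x r) =
      ∫ r in Ioi (0:ℝ), auxK ν θ x r / (μ - r * Complex.exp (θ * Complex.I)) := by
    refine setIntegral_congr_fun measurableSet_Ioi (fun r hr => ?_)
    have hr' : (0:ℝ) < r := hr
    have e : ∀ t : ℝ, ((Real.exp (-μ * t) : ℝ) : ℂ) *
      (Complex.exp (t * r * Complex.exp (θ * Complex.I)) * auxK ν θ x r) =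
      Complex.exp (-(μ - r * Complex.exp (θ * Complex.I)) * t) * auxK ν θ x r := by
      intro t
      rw [← mul_assoc, Complex.ofReal_exp, ← Complex.exp_add]
      congr 2
      push_cast
      ring
    have h0 : (-(μ - r * Complex.exp (θ * Complex.I))).re < 0 := by
      rw [Complex.neg_re, aux_den]; nlinarith
    simp_rw [e]
    rw [integral_mul_const, integral_exp_mul_complex_Ioi h0]
    simp only [Complex.ofReal_zero, mul_zero, Complex.exp_zero, neg_div_neg_eq]
    ring
  rw [← e1, ← hsw, ← integral_const_mul]
  have him := integral_im hout
  simp only [Function.uncurry, RCLike.im_to_complex] at him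
  rw [← him]
  refine setIntegral_congr_fun measurableSet_Ioi (fun t ht => ?_)
  rw [integral_const_mul, Complex.im_ofReal_mul, ← aux_repr ν θ x t hν0 hν1 h1 h2 hx ht]
  ring

/-- Shifting a contour in a horizontal strip. -/
lemma aux_shift (H : ℂ → ℂ) (θ u₀ : ℝ) (hθ : 0 ≤ θ)
    (hd : ∀ z : ℂ, 0 ≤ z.im → z.im ≤ θ → DifferentiableAt ℂ H z)
    (hreal : ∀ u : ℝ, u ≠ u₀ → (H u).im = 0)
    (hdec : ∀ ε > 0, ∃ R₀ : ℝ, ∀ u y : ℝ, R₀ ≤ |u| → 0 ≤ y → y ≤ θ →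
      ‖H (u + y * Complex.I)‖ ≤ ε) :
    (∫ u : ℝ, H (u + θ * Complex.I)).im = 0 := by
  by_cases hint : Integrable (fun u : ℝ => H (u + θ * Complex.I))
  swap
  · rw [integral_undef hint]; rfl
  have hlim := intervalIntegral_tendsto_integral hint Filter.tendsto_neg_atTop_atBot
    Filter.tendsto_id
  have hlim2 := (Complex.continuous_im.tendsto _).comp hlim
  refine tendsto_nhds_unique hlim2 ?_
  rw [Metric.tendsto_atTop]
  intro ε hε
  obtain ⟨R₀, hR⟩ := hdec (ε / (4 * (θ + 1))) (by positivity)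
  refine ⟨max R₀ 0, fun R hRR => ?_⟩
  have hR0 : R₀ ≤ R := le_trans (le_max_left _ _) hRR
  have hRp : 0 ≤ R := le_trans (le_max_right _ _) hRR
  have hrect := Complex.integral_boundary_rect_eq_zero_of_differentiableOn H
    (-R : ℝ) (R + θ * Complex.I) (by
      intro z hz
      refine (hd z ?_ ?_).differentiableWithinAt
      · have := hz.2
        simp [uIcc_of_le hθ] at this
        exact this.1
      · have := hz.2
        simp [uIcc_of_le hθ] at this
        exact this.2)
  have hz1 : ((-R : ℝ) : ℂ).re = -R := by simp
  have hz2 : ((-R : ℝ) : ℂ).im = 0 := by simp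
  have hz3 : ((R:ℂ) + θ * Complex.I).re = R := by simp
  have hz4 : ((R:ℂ) + θ * Complex.I).im = θ := by simp
  rw [hz1, hz2, hz3, hz4] at hrect
  have hvert : ∀ s : ℝ, R₀ ≤ |s| → ‖∫ y : ℝ in (0:ℝ)..θ, H (s + y * Complex.I)‖ ≤ ε / 4 := by
    intro s hs
    have := intervalIntegral.norm_integral_le_of_norm_le_const (a := 0) (b := θ)
      (f := fun y : ℝ => H (s + y * Complex.I)) (C := ε / (4 * (θ + 1))) (by
        intro y hy
        rw [uIoc_of_le hθ] at hy
        exact hR s y hs hy.1.le hy.2)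
    refine this.trans ?_
    rw [sub_zero, abs_of_nonneg hθ, div_mul_eq_mul_div, div_le_div_iff₀ (by positivity) (by positivity)]
    nlinarith
  have hv1 := hvert R (by rwa [abs_of_nonneg hRp])
  have hv2 := hvert (-R) (by rwa [abs_neg, abs_of_nonneg hRp])
  have hI : (∫ u : ℝ in (-R)..R, H (u + (0:ℝ) * Complex.I)).im = 0 := by
    have hcont : IntervalIntegrable (fun u : ℝ => H (u + (0:ℝ) * Complex.I)) volume (-R) R := by
      apply Continuous.intervalIntegrable
      rw [continuous_iff_continuousAt]
      intro u
      have h1 : ContinuousAt H ((u:ℂ) + (0:ℝ) * Complex.I) :=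
        (hd _ (by simp) (by simpa using hθ)).continuousAt
      exact ContinuousAt.comp (f := fun u : ℝ => (u:ℂ) + (0:ℝ) * Complex.I) h1 (by fun_prop)
    have := (Complex.imCLM.intervalIntegral_comp_comm hcont).symm
    simp only [Complex.imCLM_apply] at this
    rw [this]
    refine (intervalIntegral.integral_congr_ae ?_).trans intervalIntegral.integral_zero
    have hne : ∀ᵐ u : ℝ, u ≠ u₀ := by simp [ae_iff]
    filter_upwards [hne] with u hu _
    simpa using hreal u hu
  have heq : ∫ u : ℝ in (-R)..R, H (u + θ * Complex.I) =
      (∫ u : ℝ in (-R)..R, H (u + (0:ℝ) * Complex.I)) +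
      (Complex.I • (∫ y : ℝ in (0:ℝ)..θ, H (R + y * Complex.I)) -
        Complex.I • (∫ y : ℝ in (0:ℝ)..θ, H ((-R : ℝ) + y * Complex.I))) := by
    linear_combination -hrect
  have hn : ‖Complex.I • (∫ y : ℝ in (0:ℝ)..θ, H (R + y * Complex.I)) -
        Complex.I • (∫ y : ℝ in (0:ℝ)..θ, H ((-R : ℝ) + y * Complex.I))‖ ≤ ε / 2 := by
    refine (norm_sub_le _ _).trans ?_
    rw [norm_smul, norm_smul, Complex.norm_I]
    linarith
  simp only [Function.comp, id, dist_zero_right]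
  rw [heq, Complex.add_im, hI, zero_add]
  exact ((Complex.abs_im_le_norm _).trans hn).trans_lt (by linarith)

/-- Numerator in logarithmic coordinates. -/
noncomputable def auxN (ν x μ : ℝ) (w : ℂ) : ℂ :=
  Complex.exp (ν * w) * (Complex.exp (-x * Complex.exp (ν * w)) - (Real.exp (-(μ ^ ν) * x) : ℝ))

/-- Denominator in logarithmic coordinates. -/
noncomputable def auxD (μ : ℝ) (w : ℂ) : ℂ := μ - Complex.exp w

/-- The quotient with the removable singularity removed. -/
noncomputable def auxH (ν x μ : ℝ) (w : ℂ) : ℂ :=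
  dslope (auxN ν x μ) (Real.log μ : ℝ) w / dslope (auxD μ) (Real.log μ : ℝ) w

lemma auxN_diff (ν x μ : ℝ) : Differentiable ℂ (auxN ν x μ) := by
  unfold auxN; fun_prop

lemma auxD_diff (μ : ℝ) : Differentiable ℂ (auxD μ) := by
  unfold auxD; fun_prop

lemma auxN_zero (ν x μ : ℝ) (hμ : 0 < μ) : auxN ν x μ (Real.log μ : ℝ) = 0 := by
  unfold auxN
  have : Complex.exp (ν * (Real.log μ : ℝ)) = ((μ ^ ν : ℝ) : ℂ) := by
    rw [Real.rpow_def_of_pos hμ]; push_cast; congr 1; ring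
  rw [this, mul_eq_zero, sub_eq_zero]
  right
  push_cast
  congr 1
  ring

lemma auxD_zero (μ : ℝ) (hμ : 0 < μ) : auxD μ (Real.log μ : ℝ) = 0 := by
  unfold auxD
  rw [← Complex.ofReal_exp, Real.exp_log hμ, sub_self]

lemma auxH_eq (ν x μ : ℝ) (hμ : 0 < μ) (w : ℂ) (hw : w ≠ (Real.log μ : ℝ)) :
    auxH ν x μ w = auxN ν x μ w / auxD μ w := by
  unfold auxH
  rw [dslope_of_ne _ hw, dslope_of_ne _ hw, slope_def_field, slope_def_field, auxN_zero ν x μ hμ,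
    auxD_zero μ hμ, sub_zero, sub_zero, div_div_div_cancel_right₀ (sub_ne_zero.mpr hw)]

lemma auxH_diff (ν x μ : ℝ) (hμ : 0 < μ) (z : ℂ) (h0 : -Real.pi < z.im) (h1 : z.im ≤ Real.pi) :
    DifferentiableAt ℂ (auxH ν x μ) z := by
  have hN : Differentiable ℂ (dslope (auxN ν x μ) (Real.log μ : ℝ)) :=
    differentiableOn_univ.mp ((Complex.differentiableOn_dslope Filter.univ_mem).mpr
      (auxN_diff ν x μ).differentiableOn)
  have hD : Differentiable ℂ (dslope (auxD μ) (Real.log μ : ℝ)) :=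
    differentiableOn_univ.mp ((Complex.differentiableOn_dslope Filter.univ_mem).mpr
      (auxD_diff μ).differentiableOn)
  refine (hN z).div (hD z) ?_
  by_cases hz : z = (Real.log μ : ℝ)
  · rw [hz, dslope_same]
    have : HasDerivAt (auxD μ) (-Complex.exp (Real.log μ : ℝ)) (Real.log μ : ℝ) := by
      unfold auxD
      simpa using (Complex.hasDerivAt_exp ((Real.log μ : ℝ) : ℂ)).const_sub (μ : ℂ)
    rw [this.deriv]
    exact neg_ne_zero.mpr (Complex.exp_ne_zero _)
  · rw [dslope_of_ne _ hz, slope_def_field, auxD_zero μ hμ, sub_zero]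
    refine div_ne_zero ?_ (sub_ne_zero.mpr hz)
    intro h
    unfold auxD at h
    apply hz
    refine Complex.exp_inj_of_neg_pi_lt_of_le_pi h0 h1 (by simp [Real.pi_pos])
      (by simp [Real.pi_pos.le]) ?_
    rw [← Complex.ofReal_exp, Real.exp_log hμ]
    exact (sub_eq_zero.mp h).symm

lemma auxH_real (ν x μ : ℝ) (hμ : 0 < μ) (u : ℝ) (hu : u ≠ Real.log μ) :
    (auxH ν x μ u).im = 0 := by
  rw [auxH_eq ν x μ hμ u (by exact_mod_cast hu)]
  unfold auxN auxD
  have : Complex.exp (ν * u) * (Complex.exp (-x * Complex.exp (ν * u)) -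
      (Real.exp (-(μ ^ ν) * x) : ℝ)) / (μ - Complex.exp u) =
      ((Real.exp (ν * u) * (Real.exp (-x * Real.exp (ν * u)) - Real.exp (-(μ ^ ν) * x)) /
        (μ - Real.exp u) : ℝ) : ℂ) := by
    push_cast; rfl
  rw [this, Complex.ofReal_im]

lemma auxH_bound (ν θ x μ : ℝ) (hν0 : 0 < ν) (hx : 0 ≤ x) (hμ : 0 < μ)
    (hθ : θ * ν ≤ Real.pi / 2) (u y : ℝ) (hy0 : 0 ≤ y) (hy1 : y ≤ θ) (hu : Real.exp u ≠ μ) :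
    ‖auxH ν x μ (u + y * Complex.I)‖ ≤ 2 * Real.exp (ν * u) / |μ - Real.exp u| := by
  have hne : (u + y * Complex.I : ℂ) ≠ (Real.log μ : ℝ) := by
    intro h
    have := congrArg Complex.re h
    simp at this
    exact hu (by rw [this, Real.exp_log hμ])
  rw [auxH_eq ν x μ hμ _ hne, norm_div]
  have hpos : 0 < |μ - Real.exp u| := abs_pos.mpr (sub_ne_zero.mpr hu.symm)
  have hN : ‖auxN ν x μ (u + y * Complex.I)‖ ≤ 2 * Real.exp (ν * u) := by
    unfold auxN
    have e : Complex.exp (ν * (u + y * Complex.I)) = (Real.exp (ν * u) : ℝ) *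
        Complex.exp ((ν * y : ℝ) * Complex.I) := by
      rw [Complex.ofReal_exp, ← Complex.exp_add]; congr 1; push_cast; ring
    have hcos : 0 ≤ Real.cos (ν * y) := by
      apply Real.cos_nonneg_of_mem_Icc
      constructor
      · have : 0 ≤ ν * y := by positivity
        linarith [Real.pi_pos]
      · nlinarith
    rw [norm_mul, e, norm_mul, Complex.norm_real, Real.norm_of_nonneg (Real.exp_pos _).le,
      Complex.norm_exp_ofReal_mul_I, mul_one, mul_comm]
    gcongr
    refine (norm_sub_le _ _).trans ?_
    have h1 : ‖Complex.exp (-x * ((Real.exp (ν * u) : ℝ) *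
        Complex.exp ((ν * y : ℝ) * Complex.I)))‖ ≤ 1 := by
      rw [Complex.norm_exp, Real.exp_le_one_iff, ← mul_assoc, ← Complex.ofReal_neg,
        ← Complex.ofReal_mul, Complex.re_ofReal_mul, Complex.exp_ofReal_mul_I_re]
      have : 0 ≤ x * Real.exp (ν * u) * Real.cos (ν * y) := by positivity
      linarith
    have h2 : ‖((Real.exp (-(μ ^ ν) * x) : ℝ) : ℂ)‖ ≤ 1 := by
      rw [Complex.norm_real, Real.norm_of_nonneg (Real.exp_pos _).le, Real.exp_le_one_iff]
      have : 0 ≤ μ ^ ν * x := by positivity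
      linarith
    linarith
  have hD : |μ - Real.exp u| ≤ ‖auxD μ (u + y * Complex.I)‖ := by
    unfold auxD
    have := abs_norm_sub_norm_le (μ : ℂ) (Complex.exp (u + y * Complex.I))
    rw [Complex.norm_exp, Complex.norm_real, Real.norm_of_nonneg hμ.le] at this
    simpa using this
  gcongr

lemma auxH_decay (ν θ x μ : ℝ) (hν0 : 0 < ν) (hν1 : ν < 1) (hx : 0 ≤ x) (hμ : 0 < μ)
    (hθ : θ * ν ≤ Real.pi / 2) :
    ∀ ε > 0, ∃ R₀ : ℝ, ∀ u y : ℝ, R₀ ≤ |u| → 0 ≤ y → y ≤ θ →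
      ‖auxH ν x μ (u + y * Complex.I)‖ ≤ ε := by
  intro ε hε
  have t1 : Filter.Tendsto (fun u : ℝ => Real.exp ((ν - 1) * u)) Filter.atTop (nhds 0) :=
    Real.tendsto_exp_atBot.comp (Filter.tendsto_id.const_mul_atTop_of_neg (by linarith))
  have t2 : Filter.Tendsto (fun u : ℝ => Real.exp (ν * u)) Filter.atBot (nhds 0) :=
    Real.tendsto_exp_atBot.comp (Filter.tendsto_id.const_mul_atBot hν0)
  have a1 := (t1.eventually (gt_mem_nhds (show (0:ℝ) < ε / 4 by positivity))).and
    (Real.tendsto_exp_atTop.eventually (Filter.eventually_ge_atTop (2 * μ)))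
  have a2 := (t2.eventually (gt_mem_nhds (show (0:ℝ) < ε * μ / 4 by positivity))).and
    (Real.tendsto_exp_atBot.eventually (gt_mem_nhds (show (0:ℝ) < μ / 2 by positivity)))
  obtain ⟨R1, hR1⟩ := Filter.eventually_atTop.mp a1
  obtain ⟨R2, hR2⟩ := Filter.eventually_atBot.mp a2
  refine ⟨max R1 (-R2), fun u y hu hy0 hy1 => ?_⟩
  rcases le_total 0 u with h | h
  · rw [abs_of_nonneg h] at hu
    obtain ⟨b1, b2⟩ := hR1 u (le_trans (le_max_left _ _) hu)
    refine (auxH_bound ν θ x μ hν0 hx hμ hθ u y hy0 hy1 (by linarith)).trans ?_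
    have hab : Real.exp u / 2 ≤ |μ - Real.exp u| := by
      rw [abs_of_nonpos (by linarith)]; linarith
    have e : Real.exp (ν * u) = Real.exp ((ν - 1) * u) * Real.exp u := by
      rw [← Real.exp_add]; congr 1; ring
    rw [div_le_iff₀ (lt_of_lt_of_le (by positivity) hab), e]
    have := Real.exp_pos u
    nlinarith
  · rw [abs_of_nonpos h] at hu
    obtain ⟨b1, b2⟩ := hR2 u (by linarith [le_max_right R1 (-R2)])
    refine (auxH_bound ν θ x μ hν0 hx hμ hθ u y hy0 hy1 (by linarith)).trans ?_
    have hab : μ / 2 ≤ |μ - Real.exp u| := by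
      rw [abs_of_nonneg (by linarith)]; linarith
    rw [div_le_iff₀ (lt_of_lt_of_le (by positivity) hab)]
    nlinarith

/-- Step C: the difference of the ray integrals has no imaginary part. -/
lemma aux_contour (ν θ x μ : ℝ) (hν0 : 0 < ν) (hν1 : ν < 1) (hx : 0 ≤ x) (hμ : 0 < μ)
    (hθ0 : 0 < θ) (hθπ : θ < Real.pi) (hθ : θ * ν ≤ Real.pi / 2) :
    (∫ r in Ioi (0:ℝ), (auxK ν θ x r / (μ - r * Complex.exp (θ * Complex.I)) -
      (Real.exp (-(μ ^ ν) * x) : ℝ) *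
        (auxK ν θ 0 r / (μ - r * Complex.exp (θ * Complex.I))))).im = 0 := by
  have hs := aux_shift (auxH ν x μ) θ (Real.log μ) hθ0.le
    (fun z h0 h1 => auxH_diff ν x μ hμ z (by linarith [Real.pi_pos]) (by linarith))
    (fun u hu => auxH_real ν x μ hμ u hu) (auxH_decay ν θ x μ hν0 hν1 hx hμ hθ)
  refine Eq.trans ?_ hs
  congr 1
  have hcv := integral_image_eq_integral_abs_deriv_smul (s := univ) (f := Real.exp)
    (f' := Real.exp) MeasurableSet.univ (fun u _ => (Real.hasDerivAt_exp u).hasDerivWithinAt)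
    Real.exp_injective.injOn
    (fun r : ℝ => (auxK ν θ x r / (μ - r * Complex.exp (θ * Complex.I)) -
      (Real.exp (-(μ ^ ν) * x) : ℝ) *
        (auxK ν θ 0 r / (μ - r * Complex.exp (θ * Complex.I)))))
  rw [image_univ, Real.range_exp] at hcv
  rw [hcv, setIntegral_univ]
  congr 1
  funext u
  have hne : (u + θ * Complex.I : ℂ) ≠ (Real.log μ : ℝ) := by
    intro h
    have := congrArg Complex.im h
    simp at this
    exact hθ0.ne' this
  rw [auxH_eq ν x μ hμ _ hne]
  unfold auxN auxD auxK
  have e1 : Complex.exp (u + θ * Complex.I) = (Real.exp u : ℝ) * Complex.exp (θ * Complex.I) := by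
    rw [Complex.exp_add, Complex.ofReal_exp]
  have e2 : Complex.exp (ν * (u + θ * Complex.I)) = ((Real.exp u ^ ν : ℝ) : ℂ) *
      Complex.exp (θ * ν * Complex.I) := by
    rw [← Real.exp_mul, Complex.ofReal_exp, ← Complex.exp_add]; congr 1; push_cast; ring
  have e3 : ((Real.exp u ^ ν : ℝ) : ℂ) = (Real.exp u : ℝ) * ((Real.exp u ^ (ν - 1) : ℝ) : ℂ) := by
    rw [Real.rpow_sub_one (Real.exp_pos u).ne', ← Complex.ofReal_mul]
    congr 1
    field_simp
  have e4 : -((x * Real.exp u ^ ν : ℝ) : ℂ) * Complex.exp (θ * ν * Complex.I) =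
      -x * (((Real.exp u ^ ν : ℝ) : ℂ) * Complex.exp (θ * ν * Complex.I)) := by
    push_cast; ring
  rw [abs_of_pos (Real.exp_pos u), Complex.real_smul, e1, e2, e4]
  simp only [zero_mul, Complex.ofReal_zero, neg_zero, Complex.exp_zero, mul_one]
  generalize Complex.exp (-x * (((Real.exp u ^ ν : ℝ) : ℂ) * Complex.exp (θ * ν * Complex.I))) = E
  rw [e3]
  ring

lemma aux_zero (ν μ : ℝ) (hν0 : 0 < ν) (hν1 : ν < 1) (hμ : 0 < μ) :
    ∫ t in Ioi (0:ℝ), Real.exp (-μ * t) * invStableDensity ν t 0 = μ ^ (ν - 1) := by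
  have hG : 0 < Real.Gamma (1 - ν) := Real.Gamma_pos_of_pos (by linarith)
  have e : ∀ t : ℝ, Real.exp (-μ * t) * invStableDensity ν t 0 =
      (t ^ ((1 - ν) - 1) * Real.exp (-(μ * t))) * (1 / Real.Gamma (1 - ν)) := by
    intro t
    unfold invStableDensity wrightFn
    rw [tsum_eq_single 0 (by intro k hk; simp [hk])]
    rw [show (1 - ν) - 1 = -ν by ring]
    simp
    ring
  simp_rw [e]
  rw [integral_mul_const, Real.integral_rpow_mul_exp_neg_mul_Ioi (by linarith) hμ, one_div,
    Real.inv_rpow hμ.le, ← Real.rpow_neg hμ.le, neg_sub]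
  field_simp

theorem laplace_invStableDensity (ν : ℝ) (hν : ν ∈ Ioo (0:ℝ) 1) :
    ∀ x : ℝ, 0 ≤ x → ∀ μ : ℝ, 0 < μ →
      ∫ t in Ioi (0:ℝ), Real.exp (-μ * t) * invStableDensity ν t x =
        μ ^ (ν - 1) * Real.exp (-(μ ^ ν) * x) := by
  intro x hx μ hμ
  obtain ⟨hν0, hν1⟩ := hν
  have hπ := Real.pi_pos
  obtain ⟨θ, hθ⟩ : ∃ θ : ℝ, θ = Real.pi / (1 + ν) := ⟨_, rfl⟩
  have hθm : θ * (1 + ν) = Real.pi := by rw [hθ]; field_simp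
  have hθp : 0 < θ := by rw [hθ]; positivity
  have h1 : Real.pi / 2 < θ := by nlinarith
  have h2 : θ < Real.pi := by nlinarith
  have h3 : θ * ν ≤ Real.pi / 2 := by nlinarith
  have hc : 0 ≤ Real.cos (θ * ν) := by
    apply Real.cos_nonneg_of_mem_Icc
    exact ⟨by nlinarith, h3⟩
  have hd : 0 < -Real.cos θ := by
    have := Real.cos_neg_of_pi_div_two_lt_of_lt h1 (by linarith)
    linarith
  have hL := aux_laplace ν θ x μ hν0 hν1 h1 h2 hc hx hμ
  have hL0 := aux_laplace ν θ 0 μ hν0 hν1 h1 h2 hc le_rfl hμ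
  rw [aux_zero ν μ hν0 hν1 hμ] at hL0
  have hC := aux_contour ν θ x μ hν0 hν1 hx hμ hθp h2 h3
  rw [integral_sub (aux_quot_int ν θ x μ hν0 hν1 hd hc hx hμ)
    ((aux_quot_int ν θ 0 μ hν0 hν1 hd hc le_rfl hμ).const_mul _), integral_const_mul,
    Complex.sub_im, Complex.im_ofReal_mul, ← hL, ← hL0] at hC
  apply mul_left_cancel₀ hπ.ne'
  linear_combination hC
end

section
/- For ν ∈ (0,1), x > 0 and t > 0, the density u_ν(t,x) of the stable subordinator of order ν and the density l_ν(x,t) of its inverse (note the swapped arguments) satisfy u_ν(t,x) = (ν t / x) · l_ν(x, t), where l_ν(x,t) = x^{-ν} W_{-ν,1-ν}(-t x^{-ν}). Equivalently, at the level of Laplace transforms, ∫_0^∞ e^{-μx} (ν t / x) x^{-ν} W_{-ν,1-ν}(-t x^{-ν}) dx = e^{-μ^ν t} for all μ ≥ 0, t > 0. -/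
open MeasureTheory Set

lemma gamma_aux (s : ℝ) (hs : 0 ≤ s) (w : ℂ) (hw : 0 < w.re) :
    ∫ y in Ioi (0:ℝ), ((y ^ s : ℝ) : ℂ) * Complex.exp (-w * y) = Real.Gamma (s + 1) * (1 / w) ^ ((s + 1 : ℝ) : ℂ) := by
  have hmeas : ∀ (s : ℝ) (w : ℂ), 0 ≤ s → AEStronglyMeasurable (fun y : ℝ => ((y ^ s : ℝ) : ℂ) * Complex.exp (-w * y)) (volume.restrict (Ioi 0)) := by
    intro s w hs
    have : Continuous fun y : ℝ => y ^ s := Real.continuous_rpow_const hs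
    exact Continuous.aestronglyMeasurable (by fun_prop)
  have hintg : ∀ (s b : ℝ), 0 ≤ s → 0 < b → IntegrableOn (fun y : ℝ => y ^ s * Real.exp (-b * y)) (Ioi 0) := by
    intro s b hs hb
    simpa using integrableOn_rpow_mul_exp_neg_mul_rpow (p := 1) (s := s) (b := b) (by linarith) one_pos hb
  have hnorm : ∀ (s : ℝ) (w : ℂ) (y : ℝ), 0 < y → ‖((y ^ s : ℝ) : ℂ) * Complex.exp (-w * y)‖ = y ^ s * Real.exp (-w.re * y) := by
    intro s w y hy
    rw [norm_mul, Complex.norm_exp, Complex.norm_real, Real.norm_of_nonneg (by positivity)]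
    simp
  have hopen : IsOpen {w : ℂ | 0 < w.re} := isOpen_lt continuous_const Complex.continuous_re
  have hd : DifferentiableOn ℂ (fun w : ℂ => ∫ y in Ioi (0:ℝ), ((y ^ s : ℝ) : ℂ) * Complex.exp (-w * y)) {w : ℂ | 0 < w.re} := by
    intro w hw
    have hw' : 0 < w.re := hw
    refine DifferentiableAt.differentiableWithinAt ?_
    have := hasDerivAt_integral_of_dominated_loc_of_deriv_le (μ := volume.restrict (Ioi (0:ℝ)))
      (F := fun (w : ℂ) (y : ℝ) => ((y ^ s : ℝ) : ℂ) * Complex.exp (-w * y))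
      (F' := fun (w : ℂ) (y : ℝ) => ((y ^ s : ℝ) : ℂ) * (Complex.exp (-w * y) * (-y)))
      (x₀ := w) (s := {z : ℂ | w.re / 2 < z.re}) (bound := fun y => y ^ (s + 1) * Real.exp (-(w.re / 2) * y))
      ?_ ?_ ?_ ?_ ?_ ?_ ?_
    · exact this.2.differentiableAt
    · exact (isOpen_lt continuous_const Complex.continuous_re).mem_nhds (by simp; linarith)
    · exact Filter.Eventually.of_forall fun z => hmeas s z hs
    · refine Integrable.mono' (hintg s w.re hs hw') (hmeas s w hs) ?_
      refine (ae_restrict_iff' measurableSet_Ioi).2 (ae_of_all _ fun y hy => ?_)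
      exact (hnorm s w y hy).le
    · have : Continuous fun y : ℝ => y ^ s := Real.continuous_rpow_const hs
      exact Continuous.aestronglyMeasurable (by fun_prop)
    · refine (ae_restrict_iff' measurableSet_Ioi).2 (ae_of_all _ fun y hy z hz => ?_)
      have hy' : 0 < y := hy
      have hz' : w.re / 2 < z.re := hz
      rw [← mul_assoc, norm_mul, hnorm s z y hy, norm_neg, Complex.norm_real, Real.norm_of_nonneg hy'.le,
        Real.rpow_add_one hy'.ne', mul_right_comm]
      gcongr
    · exact hintg _ _ (by linarith) (by linarith)
    · refine ae_of_all _ fun y z hz => ?_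
      refine HasDerivAt.const_mul _ ?_
      have h1 : HasDerivAt (fun z : ℂ => -z * (y:ℂ)) (-(y:ℂ)) z := by
        simpa using ((hasDerivAt_id z).neg.mul_const (y:ℂ))
      exact h1.cexp
  have hd2 : DifferentiableOn ℂ (fun w : ℂ => Real.Gamma (s + 1) * (1 / w) ^ ((s + 1 : ℝ) : ℂ)) {w : ℂ | 0 < w.re} := by
    intro w hw
    have hw' : 0 < w.re := hw
    have hne : w ≠ 0 := by rintro rfl; simp at hw'
    refine DifferentiableAt.differentiableWithinAt ?_
    refine DifferentiableAt.const_mul ?_ _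
    refine DifferentiableAt.cpow ((differentiableAt_const _).div differentiableAt_id hne) (differentiableAt_const _) ?_
    rw [Complex.mem_slitPlane_iff]
    left
    rw [one_div, Complex.inv_re]
    exact div_pos hw' (Complex.normSq_pos.2 hne)
  have heq := (hd.analyticOnNhd hopen).eqOn_of_preconnected_of_frequently_eq (hd2.analyticOnNhd hopen)
    (convex_halfSpace_re_gt 0).isPreconnected (z₀ := 1) (by simp) ?_
  · exact heq hw
  · have hreal : ∀ r : ℝ, 0 < r → (∫ y in Ioi (0:ℝ), ((y ^ s : ℝ) : ℂ) * Complex.exp (-(r:ℂ) * y)) = Real.Gamma (s + 1) * (1 / (r:ℂ)) ^ ((s + 1 : ℝ) : ℂ) := by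
      intro r hr
      have h := Complex.integral_cpow_mul_exp_neg_mul_Ioi (a := ((s + 1 : ℝ) : ℂ)) (r := r) (by rw [Complex.ofReal_re]; linarith) hr
      rw [Complex.Gamma_ofReal] at h
      rw [mul_comm, ← h]
      refine setIntegral_congr_fun measurableSet_Ioi fun y hy => ?_
      rw [Complex.ofReal_cpow (le_of_lt hy), neg_mul]
      congr 2
      push_cast; ring
    have ht : Filter.Tendsto (fun n : ℕ => ((1 + 1 / ((n:ℝ) + 1) : ℝ) : ℂ)) Filter.atTop (nhdsWithin 1 {1}ᶜ) := by
      refine tendsto_nhdsWithin_iff.2 ⟨?_, ?_⟩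
      · have h1 : Filter.Tendsto (fun n : ℕ => (1 + 1 / ((n:ℝ) + 1) : ℝ)) Filter.atTop (nhds (1 + 0)) :=
          tendsto_one_div_add_atTop_nhds_zero_nat.const_add 1
        have := (Complex.continuous_ofReal.tendsto _).comp h1
        simpa [Function.comp_def] using this
      · refine Filter.Eventually.of_forall fun n => ?_
        have : (1 / ((n:ℝ) + 1)) ≠ 0 := by positivity
        simp only [mem_compl_iff, mem_singleton_iff]
        intro h
        have h' : (1 + 1 / ((n:ℝ) + 1) : ℝ) = 1 := by exact_mod_cast h
        apply this; linarith
    refine ht.frequently (Filter.Eventually.frequently (Filter.Eventually.of_forall fun n => ?_))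
    exact hreal _ (by positivity)


lemma aux_summable (ν : ℝ) (hν : ν ∈ Ioo (0:ℝ) 1) (a : ℝ) (ha : 0 < a) :
    Summable (fun n : ℕ => a ^ n / (Nat.factorial n) * Real.Gamma (ν * n + 1)) := by
  have h1 : Summable (fun n : ℕ => a ^ n * ((Nat.factorial n : ℝ)) ^ (ν - 1)) := by
    refine summable_of_ratio_test_tendsto_lt_one (l := 0) (by norm_num) ?_ ?_
    · filter_upwards with n
      positivity
    · have : Filter.Tendsto (fun n : ℕ => a * ((n : ℝ) + 1) ^ (-(1 - ν))) Filter.atTop (nhds (a * 0)) := by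
        refine Filter.Tendsto.const_mul _ ?_
        refine (tendsto_rpow_neg_atTop (by linarith [hν.2])).comp ?_
        exact Filter.tendsto_atTop_add_const_right _ _ tendsto_natCast_atTop_atTop
      rw [mul_zero] at this
      refine this.congr fun n => ?_
      rw [Real.norm_of_nonneg (by positivity), Real.norm_of_nonneg (by positivity)]
      rw [Nat.factorial_succ]
      push_cast
      rw [Real.mul_rpow (by positivity) (by positivity)]
      have : (0:ℝ) < (Nat.factorial n : ℝ) ^ (ν - 1) := by positivity
      rw [show -(1-ν) = ν - 1 by ring]
      field_simp
      ring
  refine Summable.of_nonneg_of_le (fun n => ?_) (fun n => ?_) h1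
  · have : 0 < Real.Gamma (ν * n + 1) := Real.Gamma_pos_of_pos (by have := hν.1; positivity)
    positivity
  · have h := Real.Gamma_mul_add_mul_le_rpow_Gamma_mul_rpow_Gamma (s := (n:ℝ)+1) (t := 1) (a := ν) (b := 1 - ν)
      (by positivity) one_pos hν.1 (by linarith [hν.2]) (by ring)
    rw [Real.Gamma_nat_eq_factorial, Real.Gamma_one, Real.one_rpow, mul_one, mul_one] at h
    rw [show ν * (n+1:ℝ) + (1 - ν) = ν * n + 1 by ring] at h
    rw [Real.rpow_sub_one (by positivity)]
    calc a ^ n / (Nat.factorial n) * Real.Gamma (ν * n + 1) ≤ a ^ n / (Nat.factorial n) * (Nat.factorial n : ℝ) ^ ν := by gcongr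
      _ = _ := by ring

noncomputable def cph (ν : ℝ) : ℂ := Complex.exp ((Real.pi * ν / 2 : ℝ) * Complex.I)

noncomputable def phi (ν t y : ℝ) : ℂ := Complex.exp (-(t * (y ^ ν : ℝ) * cph ν))

lemma norm_cph (ν : ℝ) : ‖cph ν‖ = 1 := Complex.norm_exp_ofReal_mul_I _

lemma aux_series (ν : ℝ) (hν : ν ∈ Ioo (0:ℝ) 1) (t : ℝ) (ht : 0 < t) (w : ℂ) (hw : 0 < w.re) :
    ∫ y in Ioi (0:ℝ), Complex.exp (-w * y) * phi ν t y =
      ∑' n : ℕ, (-(t * cph ν)) ^ n / (Nat.factorial n) * Real.Gamma (ν * n + 1) * (1 / w) ^ (((ν * n + 1 : ℝ)) : ℂ) := by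
  have hν0 := hν.1
  have h := hasSum_integral_of_summable_integral_norm (μ := volume.restrict (Ioi (0:ℝ)))
    (F := fun (n : ℕ) (y : ℝ) => (-(t * cph ν)) ^ n / (Nat.factorial n) * (((y ^ (ν * n) : ℝ) : ℂ) * Complex.exp (-w * y))) ?_ ?_
  · refine Eq.trans ?_ (h.tsum_eq.symm.trans (tsum_congr fun n => ?_))
    rotate_left
    · symm
      rw [integral_const_mul]
      rw [gamma_aux _ (by positivity) w hw, mul_assoc]
    · refine setIntegral_congr_fun measurableSet_Ioi fun y hy => ?_
      rw [phi, Complex.exp_eq_exp_ℂ, NormedSpace.exp_eq_tsum_div (𝔸 := ℂ), ← tsum_mul_left]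
      refine tsum_congr fun n => ?_
      rw [Real.rpow_mul (le_of_lt hy), Real.rpow_natCast]
      push_cast
      rw [show -((t:ℂ) * ((y ^ ν : ℝ) : ℂ) * cph ν) = (-(t * cph ν)) * ((y ^ ν : ℝ) : ℂ) by ring, mul_pow]
      ring
  · intro n
    refine Integrable.const_mul ?_ _
    have hn : 0 ≤ ν * n := by positivity
    have := integrableOn_rpow_mul_exp_neg_mul_rpow (p := 1) (s := ν * n) (b := w.re) (by linarith) one_pos hw
    refine Integrable.mono' this ?_ ?_
    · refine ContinuousOn.aestronglyMeasurable ?_ measurableSet_Ioi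
      refine ContinuousOn.mul ?_ (by fun_prop)
      refine Complex.continuous_ofReal.comp_continuousOn ?_
      exact ContinuousOn.rpow_const (by fun_prop) (fun y hy => Or.inl (ne_of_gt hy))
    · refine (ae_restrict_iff' measurableSet_Ioi).2 (ae_of_all _ fun y hy => ?_)
      have hy' : (0:ℝ) < y := hy
      rw [norm_mul, Complex.norm_exp, Complex.norm_real, Real.norm_of_nonneg (by positivity)]
      simp
  · have hs := aux_summable ν hν (t * (1 / w.re) ^ ν) (by positivity)
    refine (hs.mul_left (1 / w.re)).congr fun n => ?_
    have e : ∀ y ∈ Ioi (0:ℝ), ‖(-(t * cph ν)) ^ n / (Nat.factorial n) * (((y ^ (ν * n) : ℝ) : ℂ) * Complex.exp (-w * y))‖ = t ^ n / (Nat.factorial n) * (y ^ (ν * n + 1 - 1) * Real.exp (-(w.re * y))) := by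
      intro y hy
      have hy' : (0:ℝ) < y := hy
      rw [norm_mul, norm_mul, norm_div, norm_pow, norm_neg, norm_mul, norm_cph, Complex.norm_exp, Complex.norm_real, Real.norm_of_nonneg ht.le, Complex.norm_real, Real.norm_of_nonneg (by positivity : 0 ≤ y ^ (ν * n))]
      simp
    rw [setIntegral_congr_fun measurableSet_Ioi e, integral_const_mul, Real.integral_rpow_mul_exp_neg_mul_Ioi (by positivity) hw]
    rw [Real.rpow_add (by positivity), Real.rpow_mul (by positivity), Real.rpow_natCast, mul_pow, Real.rpow_one]
    ring

lemma cos_pos_aux (ν : ℝ) (hν : ν ∈ Ioo (0:ℝ) 1) : 0 < Real.cos (Real.pi * ν / 2) := by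
  have := Real.pi_pos
  apply Real.cos_pos_of_mem_Ioo
  constructor <;> nlinarith [hν.1, hν.2]

lemma cph_re (ν : ℝ) : (cph ν).re = Real.cos (Real.pi * ν / 2) := by
  rw [cph, Complex.exp_ofReal_mul_I_re]

lemma norm_phi (ν t y : ℝ) :
    ‖phi ν t y‖ = Real.exp (-(t * Real.cos (Real.pi * ν / 2)) * y ^ ν) := by
  rw [phi, Complex.norm_exp]
  congr 1
  rw [Complex.neg_re, ← Complex.ofReal_mul, Complex.re_ofReal_mul, cph_re]
  ring

lemma continuous_phi (ν : ℝ) (hν : ν ∈ Ioo (0:ℝ) 1) (t : ℝ) : Continuous (phi ν t) := by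
  unfold phi
  have : Continuous fun y : ℝ => y ^ ν := Real.continuous_rpow_const hν.1.le
  fun_prop

lemma integrable_norm_phi (ν : ℝ) (hν : ν ∈ Ioo (0:ℝ) 1) (t : ℝ) (ht : 0 < t) :
    IntegrableOn (fun y => ‖phi ν t y‖) (Ioi 0) := by
  have := integrableOn_rpow_mul_exp_neg_mul_rpow (p := ν) (s := 0) (b := t * Real.cos (Real.pi * ν / 2))
    (by norm_num) hν.1 (mul_pos ht (cos_pos_aux ν hν))
  simp_rw [norm_phi]
  simpa using this

lemma integrable_phi (ν : ℝ) (hν : ν ∈ Ioo (0:ℝ) 1) (t : ℝ) (ht : 0 < t) :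
    IntegrableOn (phi ν t) (Ioi 0) :=
  (integrable_norm_iff (continuous_phi ν hν t).aestronglyMeasurable).1 (integrable_norm_phi ν hν t ht)

lemma aux_boundary (ν : ℝ) (hν : ν ∈ Ioo (0:ℝ) 1) (t : ℝ) (ht : 0 < t) (x : ℝ) (hx : x ≠ 0) :
    ∫ y in Ioi (0:ℝ), Complex.exp (x * y * Complex.I) * phi ν t y =
      ∑' n : ℕ, (-(t * cph ν)) ^ n / (Nat.factorial n) * Real.Gamma (ν * n + 1) *
        (((1 / x : ℝ) : ℂ) * Complex.I) ^ (((ν * n + 1 : ℝ)) : ℂ) := by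
  have hν0 := hν.1
  have hinv : 1 / (-(x * Complex.I)) = (((1 / x : ℝ) : ℂ) * Complex.I) := by
    have : (x : ℂ) ≠ 0 := by exact_mod_cast hx
    push_cast
    field_simp
    simp
  have L1 : Filter.Tendsto (fun ε : ℝ => ∫ y in Ioi (0:ℝ), Complex.exp (-(ε - x * Complex.I) * y) * phi ν t y)
      (nhdsWithin 0 (Ioi 0)) (nhds (∫ y in Ioi (0:ℝ), Complex.exp (x * y * Complex.I) * phi ν t y)) := by
    refine tendsto_integral_filter_of_dominated_convergence (fun y => ‖phi ν t y‖) ?_ ?_ (integrable_norm_phi ν hν t ht) ?_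
    · filter_upwards with ε
      have := continuous_phi ν hν t
      exact Continuous.aestronglyMeasurable (by fun_prop)
    · filter_upwards [self_mem_nhdsWithin] with ε hε
      refine (ae_restrict_iff' measurableSet_Ioi).2 (ae_of_all _ fun y hy => ?_)
      rw [norm_mul]
      refine mul_le_of_le_one_left (norm_nonneg _) ?_
      rw [Complex.norm_exp, Real.exp_le_one_iff]
      simp
      exact mul_nonneg (le_of_lt hε) (le_of_lt hy)
    · refine ae_of_all _ fun y => ?_
      refine Filter.Tendsto.mul_const _ ?_
      have : ContinuousAt (fun ε : ℝ => Complex.exp (-(ε - x * Complex.I) * y)) 0 := by fun_prop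
      have h2 := this.tendsto.mono_left (nhdsWithin_le_nhds (s := Ioi 0))
      convert h2 using 3
      push_cast; ring
  have L2 : Filter.Tendsto (fun ε : ℝ => ∑' n : ℕ, (-(t * cph ν)) ^ n / (Nat.factorial n) * Real.Gamma (ν * n + 1) *
        (1 / (ε - x * Complex.I)) ^ (((ν * n + 1 : ℝ)) : ℂ))
      (nhdsWithin 0 (Ioi 0)) (nhds (∑' n : ℕ, (-(t * cph ν)) ^ n / (Nat.factorial n) * Real.Gamma (ν * n + 1) *
        (((1 / x : ℝ) : ℂ) * Complex.I) ^ (((ν * n + 1 : ℝ)) : ℂ))) := by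
    have hs := aux_summable ν hν (t * (1 / |x|) ^ ν) (by positivity)
    refine tendsto_tsum_of_dominated_convergence (hs.mul_left (1 / |x|)) ?_ ?_
    · intro n
      refine Filter.Tendsto.const_mul _ ?_
      have hc : ContinuousAt (fun ε : ℝ => (1 / (ε - x * Complex.I)) ^ (((ν * n + 1 : ℝ)) : ℂ)) 0 := by
        refine ContinuousAt.cpow ?_ continuousAt_const ?_
        · refine ContinuousAt.div (by fun_prop) (by fun_prop) ?_
          simpa using hx
        · rw [Complex.ofReal_zero, zero_sub, hinv, Complex.mem_slitPlane_iff]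
          right; simpa using hx
      have h2 := hc.tendsto.mono_left (nhdsWithin_le_nhds (s := Ioi 0))
      rwa [Complex.ofReal_zero, zero_sub, hinv] at h2
    · filter_upwards [self_mem_nhdsWithin] with ε hε n
      have hG : 0 < Real.Gamma (ν * n + 1) := Real.Gamma_pos_of_pos (by positivity)
      rw [norm_mul, norm_mul, norm_div, norm_pow, norm_neg, norm_mul, norm_cph, Complex.norm_cpow_real,
        Complex.norm_real, Real.norm_of_nonneg ht.le, Complex.norm_real, Real.norm_of_nonneg hG.le]
      have hle : ‖1 / ((ε:ℂ) - x * Complex.I)‖ ≤ 1 / |x| := by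
        rw [norm_div, norm_one]
        refine one_div_le_one_div_of_le (by positivity) ?_
        have := Complex.abs_im_le_norm ((ε:ℂ) - x * Complex.I)
        simpa using this
      have hle2 : ‖1 / ((ε:ℂ) - x * Complex.I)‖ ^ (ν * n + 1) ≤ (1 / |x|) ^ (ν * n + 1) :=
        Real.rpow_le_rpow (norm_nonneg _) hle (by positivity)
      have e : (1 / |x|) ^ (ν * n + 1) = ((1 / |x|) ^ ν) ^ n * (1 / |x|) := by
        rw [Real.rpow_add (by positivity), Real.rpow_mul (by positivity), Real.rpow_natCast, Real.rpow_one]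
      rw [e] at hle2
      simp only [RCLike.norm_natCast, mul_one]
      calc _ ≤ t ^ n / (Nat.factorial n) * Real.Gamma (ν * n + 1) * (((1 / |x|) ^ ν) ^ n * (1 / |x|)) := by gcongr
        _ = _ := by rw [mul_pow]; ring
  refine tendsto_nhds_unique L1 (L2.congr' ?_)
  filter_upwards [self_mem_nhdsWithin] with ε hε
  rw [aux_series ν hν t ht _ (by simpa using hε)]

lemma I_cpow_aux (a : ℝ) (ha : 0 < a) (r : ℝ) :
    ((a : ℂ) * Complex.I) ^ (r : ℂ) = ((a ^ r : ℝ) : ℂ) * Complex.exp ((Real.pi * r / 2 : ℝ) * Complex.I) := by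
  rw [Complex.cpow_def_of_ne_zero (by simp [ha.ne']), Complex.log_ofReal_mul ha Complex.I_ne_zero, Complex.log_I,
    Real.rpow_def_of_pos ha, Complex.ofReal_exp, ← Complex.exp_add]
  congr 1
  push_cast; ring

lemma neg_I_cpow_aux (a : ℝ) (ha : 0 < a) (r : ℝ) :
    ((a : ℂ) * (-Complex.I)) ^ (r : ℂ) = ((a ^ r : ℝ) : ℂ) * Complex.exp ((-(Real.pi * r / 2) : ℝ) * Complex.I) := by
  rw [Complex.cpow_def_of_ne_zero (by simp [ha.ne']), Complex.log_ofReal_mul ha (by simp), Complex.log_neg_I,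
    Real.rpow_def_of_pos ha, Complex.ofReal_exp, ← Complex.exp_add]
  congr 1
  push_cast; ring

noncomputable def coefA (ν t x : ℝ) (n : ℕ) : ℝ :=
  t ^ n / (Nat.factorial n) * Real.Gamma (ν * n + 1) * (1 / x) ^ (ν * n + 1)

lemma coefA_nonneg (ν : ℝ) (hν : ν ∈ Ioo (0:ℝ) 1) (t : ℝ) (ht : 0 < t) (x : ℝ) (hx : 0 < x) (n : ℕ) :
    0 ≤ coefA ν t x n := by
  have hν0 := hν.1
  have hG : 0 < Real.Gamma (ν * n + 1) := Real.Gamma_pos_of_pos (by positivity)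
  unfold coefA
  positivity

lemma coefA_summable (ν : ℝ) (hν : ν ∈ Ioo (0:ℝ) 1) (t : ℝ) (ht : 0 < t) (x : ℝ) (hx : 0 < x) :
    Summable (coefA ν t x) := by
  have hs := aux_summable ν hν (t * (1 / x) ^ ν) (by positivity)
  refine (hs.mul_left (1 / x)).congr fun n => ?_
  rw [coefA, Real.rpow_add (by positivity), Real.rpow_mul (by positivity), Real.rpow_natCast, Real.rpow_one, mul_pow]
  ring

lemma cph_pow (ν : ℝ) (n : ℕ) : cph ν ^ n = Complex.exp ((Real.pi * ν / 2 * n : ℝ) * Complex.I) := by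
  rw [cph, ← Complex.exp_nat_mul]
  congr 1
  push_cast; ring

lemma re_tsum_aux (A : ℕ → ℝ) (hA : Summable A) (hA0 : ∀ n, 0 ≤ A n) (θ : ℕ → ℝ) :
    (∑' n : ℕ, ((((-1) ^ n * A n : ℝ)) : ℂ) * Complex.exp ((θ n : ℝ) * Complex.I)).re
      = ∑' n : ℕ, (-1) ^ n * A n * Real.cos (θ n) := by
  rw [Complex.re_tsum]
  · refine tsum_congr fun n => ?_
    rw [Complex.re_ofReal_mul, Complex.exp_ofReal_mul_I_re]
  · refine Summable.of_norm ?_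
    refine hA.congr fun n => ?_
    rw [norm_mul, Complex.norm_exp_ofReal_mul_I, Complex.norm_real, norm_mul]
    simp [abs_of_nonneg (hA0 n)]

noncomputable def gfun (ν t x : ℝ) : ℝ := ∫ y in Ioi (0:ℝ), Real.cos (x * y) * (phi ν t y).re

lemma integrable_exp_phi (ν : ℝ) (hν : ν ∈ Ioo (0:ℝ) 1) (t : ℝ) (ht : 0 < t) (x : ℝ) :
    IntegrableOn (fun y : ℝ => Complex.exp (x * y * Complex.I) * phi ν t y) (Ioi 0) := by
  refine Integrable.mono' (integrable_norm_phi ν hν t ht) ?_ ?_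
  · have := continuous_phi ν hν t
    exact Continuous.aestronglyMeasurable (by fun_prop)
  · refine ae_of_all _ fun y => ?_
    rw [norm_mul, ← Complex.ofReal_mul, Complex.norm_exp_ofReal_mul_I, one_mul]

lemma gfun_series (ν : ℝ) (hν : ν ∈ Ioo (0:ℝ) 1) (t : ℝ) (ht : 0 < t) (x : ℝ) (hx : 0 < x) :
    2 * gfun ν t x = ∑' n : ℕ, (-1) ^ n * coefA ν t x n * (-Real.sin (Real.pi * (ν * n))) := by
  have hp : (∫ y in Ioi (0:ℝ), Complex.exp (x * y * Complex.I) * phi ν t y).re =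
      ∑' n : ℕ, (-1) ^ n * coefA ν t x n * (-Real.sin (Real.pi * (ν * n))) := by
    rw [aux_boundary ν hν t ht x hx.ne']
    refine Eq.trans ?_ ((re_tsum_aux _ (coefA_summable ν hν t ht x hx) (coefA_nonneg ν hν t ht x hx)
      (fun n => Real.pi * (ν * n) + Real.pi / 2)).trans ?_)
    · congr 1
      refine tsum_congr fun n => ?_
      rw [I_cpow_aux _ (by positivity), neg_pow, mul_pow, cph_pow, coefA]
      rw [show Real.pi * (ν * n) + Real.pi / 2 = Real.pi * ν / 2 * n + Real.pi * (ν * n + 1) / 2 by ring,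
        Complex.ofReal_add, add_mul, Complex.exp_add]
      push_cast; ring
    · refine tsum_congr fun n => ?_
      rw [Real.cos_add_pi_div_two]
  have hm : (∫ y in Ioi (0:ℝ), Complex.exp ((-x : ℝ) * y * Complex.I) * phi ν t y).re = 0 := by
    rw [aux_boundary ν hν t ht (-x) (by simpa using hx.ne')]
    refine Eq.trans ?_ ((re_tsum_aux _ (coefA_summable ν hν t ht x hx) (coefA_nonneg ν hν t ht x hx)
      (fun n => -(Real.pi / 2))).trans ?_)
    · congr 1
      refine tsum_congr fun n => ?_
      rw [show ((1 / (-x) : ℝ) : ℂ) * Complex.I = ((1 / x : ℝ) : ℂ) * (-Complex.I) by push_cast; ring]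
      rw [neg_I_cpow_aux _ (by positivity), neg_pow, mul_pow, cph_pow, coefA]
      rw [show -(Real.pi / 2) = Real.pi * ν / 2 * n + -(Real.pi * (ν * n + 1) / 2) by ring,
        Complex.ofReal_add, add_mul, Complex.exp_add]
      push_cast; ring
    · simp
  have hpm := congrArg₂ (· + ·) hp hm
  simp only [add_zero] at hpm
  rw [← hpm, ← Complex.add_re,
    ← integral_add (integrable_exp_phi ν hν t ht x) (integrable_exp_phi ν hν t ht (-x)), gfun, ← integral_const_mul]
  have := integral_re (𝕜 := ℂ) ((integrable_exp_phi ν hν t ht x).add (integrable_exp_phi ν hν t ht (-x)))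
  simp only [Pi.add_apply, RCLike.re_to_complex] at this
  rw [← this]
  refine integral_congr_ae (ae_of_all _ fun y => ?_)
  simp only [Complex.add_re, Complex.mul_re]
  rw [← Complex.ofReal_mul, ← Complex.ofReal_mul, Complex.exp_ofReal_mul_I_re, Complex.exp_ofReal_mul_I_re,
    Complex.exp_ofReal_mul_I_im, Complex.exp_ofReal_mul_I_im, neg_mul, Real.cos_neg, Real.sin_neg]
  ring


lemma density_eq (ν : ℝ) (hν : ν ∈ Ioo (0:ℝ) 1) (t : ℝ) (ht : 0 < t) (x : ℝ) (hx : 0 < x) :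
    (ν * t / x) * (x ^ (-ν) * wrightFn (-ν) (1 - ν) (-(t * x ^ (-ν)))) = 2 / Real.pi * gfun ν t x := by
  have hν0 := hν.1
  have hpi := Real.pi_pos
  rw [show 2 / Real.pi * gfun ν t x = 2 * gfun ν t x / Real.pi by ring, gfun_series ν hν t ht x hx, Summable.tsum_eq_zero_add]
  · rw [eq_div_iff hpi.ne']
    simp only [CharP.cast_eq_zero, mul_zero, Real.sin_zero, neg_zero, zero_add]
    rw [wrightFn, ← tsum_mul_left, ← tsum_mul_left, ← tsum_mul_right]
    refine tsum_congr fun k => ?_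
    have hs : 0 < ν * (k + 1 : ℝ) := by positivity
    have hrefl := Real.Gamma_mul_Gamma_one_sub (ν * (k + 1 : ℝ))
    have hG := Real.Gamma_pos_of_pos hs
    have hinv : Real.pi / Real.Gamma (1 - ν * (k + 1)) = Real.Gamma (ν * (k + 1)) * Real.sin (Real.pi * (ν * (k + 1))) := by
      by_cases hz : Real.sin (Real.pi * (ν * (k + 1))) = 0
      · rw [hz, div_zero] at hrefl
        have : Real.Gamma (1 - ν * (k + 1)) = 0 := by
          rcases mul_eq_zero.1 hrefl with h | h
          · exact absurd h hG.ne'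
          · exact h
        rw [this, hz]; simp
      · have hne : Real.Gamma (1 - ν * (k + 1)) ≠ 0 := by
          intro h
          rw [h, mul_zero] at hrefl
          exact (div_ne_zero hpi.ne' hz) hrefl.symm
        rw [eq_div_iff hz] at hrefl
        rw [div_eq_iff hne]; linear_combination -hrefl
    have hxp : (1 / x) ^ (ν * ((k + 1 : ℕ) : ℝ) + 1) = (1 / x) * (x ^ (-ν) * (x ^ (-ν)) ^ k) := by
      rw [← pow_succ', ← Real.rpow_natCast, ← Real.rpow_mul hx.le, one_div, Real.inv_rpow hx.le, ← Real.rpow_neg hx.le,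
        neg_add, Real.rpow_add hx, Real.rpow_neg_one]
      ring_nf
    rw [coefA, hxp, show -ν * (k:ℝ) + (1 - ν) = 1 - ν * (k + 1) by ring]
    push_cast
    rw [Real.Gamma_add_one hs.ne', Nat.factorial_succ]
    push_cast
    calc _ = ν * t / x * x ^ (-ν) * (-(t * x ^ (-ν))) ^ k / (Nat.factorial k) * (Real.pi / Real.Gamma (1 - ν * (k + 1))) := by
            ring
      _ = _ := by
            rw [hinv, neg_pow, mul_pow]
            field_simp
            ring
  · refine Summable.of_norm_bounded (coefA_summable ν hν t ht x hx) fun n => ?_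
    rw [norm_mul, norm_mul, norm_neg, norm_pow, norm_neg, norm_one, one_pow, one_mul, 
      Real.norm_of_nonneg (coefA_nonneg ν hν t ht x hx n)]
    exact mul_le_of_le_one_right (coefA_nonneg ν hν t ht x hx n) (Real.abs_sin_le_one _)

lemma norm_re_phi_le (ν t y : ℝ) : ‖(phi ν t y).re‖ ≤ ‖phi ν t y‖ := Complex.abs_re_le_norm _

lemma integrable_re_phi (ν : ℝ) (hν : ν ∈ Ioo (0:ℝ) 1) (t : ℝ) (ht : 0 < t) :
    IntegrableOn (fun y => (phi ν t y).re) (Ioi 0) := (integrable_phi ν hν t ht).re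

lemma laplace_cos (μ y : ℝ) (hμ : 0 < μ) :
    ∫ x in Ioi (0:ℝ), Real.exp (-μ * x) * Real.cos (x * y) = μ / (μ ^ 2 + y ^ 2) := by
  have ha : (-(μ:ℂ) + y * Complex.I).re < 0 := by simpa using hμ
  have h := integral_exp_mul_complex_Ioi ha 0
  have hi := integrableOn_exp_mul_complex_Ioi ha 0
  have h2 := integral_re (𝕜 := ℂ) hi
  simp only [RCLike.re_to_complex] at h2
  rw [h] at h2
  refine Eq.trans ?_ (h2.trans ?_)
  · refine integral_congr_ae (ae_of_all _ fun x => ?_)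
    simp only
    rw [Complex.exp_re]
    simp [mul_comm]
  · rw [Complex.div_re]
    simp [Complex.normSq_apply]
    ring

lemma laplace_gfun (ν : ℝ) (hν : ν ∈ Ioo (0:ℝ) 1) (t : ℝ) (ht : 0 < t) (μ : ℝ) (hμ : 0 < μ) :
    ∫ x in Ioi (0:ℝ), Real.exp (-μ * x) * gfun ν t x = ∫ y in Ioi (0:ℝ), (μ / (μ ^ 2 + y ^ 2)) * (phi ν t y).re := by
  have e1 : ∀ x, Real.exp (-μ * x) * gfun ν t x = ∫ y in Ioi (0:ℝ), Real.exp (-μ * x) * (Real.cos (x * y) * (phi ν t y).re) := by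
    intro x
    rw [gfun, integral_const_mul]
  simp_rw [e1]
  rw [integral_integral_swap]
  · refine integral_congr_ae (ae_of_all _ fun y => ?_)
    simp only
    rw [← laplace_cos μ y hμ, ← integral_mul_const]
    simp_rw [mul_assoc]
  · have h1 : IntegrableOn (fun x => Real.exp (-μ * x)) (Ioi 0) := integrableOn_exp_mul_Ioi (by linarith) 0
    refine Integrable.mono' (h1.mul_prod (integrable_norm_phi ν hν t ht)) ?_ ?_
    · have := continuous_phi ν hν t
      have h3 : Continuous (Function.uncurry fun x y => Real.exp (-μ * x) * (Real.cos (x * y) * (phi ν t y).re)) := by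
        unfold Function.uncurry
        fun_prop
      exact h3.aestronglyMeasurable
    · refine ae_of_all _ fun p => ?_
      simp only [Function.uncurry]
      rw [norm_mul, norm_mul, Real.norm_of_nonneg (Real.exp_pos _).le]
      refine mul_le_mul_of_nonneg_left ?_ (Real.exp_pos _).le
      calc _ ≤ 1 * ‖phi ν t p.2‖ := mul_le_mul (Real.abs_cos_le_one _) (norm_re_phi_le _ _ _) (norm_nonneg _) zero_le_one
      _ = _ := one_mul _

lemma abs_gfun_le (ν : ℝ) (hν : ν ∈ Ioo (0:ℝ) 1) (t : ℝ) (ht : 0 < t) (x : ℝ) :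
    ‖gfun ν t x‖ ≤ ∫ y in Ioi (0:ℝ), ‖phi ν t y‖ := by
  refine norm_integral_le_of_norm_le (integrable_norm_phi ν hν t ht) (ae_of_all _ fun y => ?_)
  rw [norm_mul]
  calc ‖Real.cos (x * y)‖ * ‖(phi ν t y).re‖ ≤ 1 * ‖phi ν t y‖ := mul_le_mul (Real.abs_cos_le_one _) (norm_re_phi_le _ _ _) (norm_nonneg _) zero_le_one
      _ = _ := one_mul _

lemma continuous_gfun (ν : ℝ) (hν : ν ∈ Ioo (0:ℝ) 1) (t : ℝ) (ht : 0 < t) : Continuous (gfun ν t) := by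
  have := continuous_phi ν hν t
  refine continuous_of_dominated (bound := fun y => ‖phi ν t y‖) ?_ ?_ (integrable_norm_phi ν hν t ht) ?_
  · intro x
    exact Continuous.aestronglyMeasurable (by fun_prop)
  · intro x
    refine ae_of_all _ fun y => ?_
    rw [norm_mul]
    calc ‖Real.cos (x * y)‖ * ‖(phi ν t y).re‖ ≤ 1 * ‖phi ν t y‖ := mul_le_mul (Real.abs_cos_le_one _) (norm_re_phi_le _ _ _) (norm_nonneg _) zero_le_one
      _ = _ := one_mul _
  · exact ae_of_all _ fun y => by fun_prop

lemma gfun_tail (ν : ℝ) (hν : ν ∈ Ioo (0:ℝ) 1) (t : ℝ) (ht : 0 < t) (x : ℝ) (hx : 1 ≤ x) :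
    ‖gfun ν t x‖ ≤ (∑' n, coefA ν t 1 n) * x ^ (-(ν + 1)) := by
  have hx0 : 0 < x := by linarith
  have hν0 := hν.1
  have h := gfun_series ν hν t ht x hx0
  have hb : ‖2 * gfun ν t x‖ ≤ ∑' n, coefA ν t 1 n * x ^ (-(ν + 1)) := by
    rw [h]
    refine tsum_of_norm_bounded ((coefA_summable ν hν t ht 1 one_pos).mul_right _).hasSum fun n => ?_
    have hA := coefA_nonneg ν hν t ht x hx0 n
    have hA1 := coefA_nonneg ν hν t ht 1 one_pos n
    rcases Nat.eq_zero_or_pos n with rfl | hn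
    · simp only [CharP.cast_eq_zero, mul_zero, Real.sin_zero, neg_zero, norm_zero]
      positivity
    · rw [norm_mul, norm_mul, norm_neg, norm_pow, norm_neg, norm_one, one_pow, one_mul, Real.norm_of_nonneg hA]
      refine (mul_le_of_le_one_right hA (Real.abs_sin_le_one _)).trans ?_
      unfold coefA
      rw [div_one, Real.one_rpow, mul_one, Real.rpow_neg hx0.le, ← Real.inv_rpow hx0.le, ← one_div]
      have hG : 0 < Real.Gamma (ν * n + 1) := Real.Gamma_pos_of_pos (by positivity)
      have hn1 : (1:ℝ) ≤ n := by exact_mod_cast hn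
      refine mul_le_mul_of_nonneg_left ?_ (by positivity)
      refine Real.rpow_le_rpow_of_exponent_ge (by positivity) ?_ ?_
      · rw [div_le_one hx0]; exact hx
      · nlinarith
  rw [tsum_mul_right, norm_mul, Real.norm_two] at hb
  linarith [norm_nonneg (gfun ν t x)]

lemma integrable_gfun (ν : ℝ) (hν : ν ∈ Ioo (0:ℝ) 1) (t : ℝ) (ht : 0 < t) : IntegrableOn (gfun ν t) (Ioi 0) := by
  rw [← Ioc_union_Ioi_eq_Ioi (zero_le_one' ℝ)]
  refine IntegrableOn.union ?_ ?_
  · exact ((continuous_gfun ν hν t ht).integrableOn_Icc (a := 0) (b := 1)).mono_set Ioc_subset_Icc_self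
  · have h := (integrableOn_Ioi_rpow_of_lt (a := -(ν + 1)) (by linarith [hν.1]) one_pos).const_mul (∑' n, coefA ν t 1 n)
    refine Integrable.mono' h (continuous_gfun ν hν t ht).aestronglyMeasurable ?_
    refine (ae_restrict_iff' measurableSet_Ioi).2 (ae_of_all _ fun x hx => ?_)
    exact gfun_tail ν hν t ht x (le_of_lt hx)

lemma exp_two_aux (h : ℝ) (hc : Real.cos h ≠ 0) :
    1 + Complex.exp (((2 * h : ℝ) : ℂ) * Complex.I) ≠ 0 ∧
    (1 - Complex.exp (((2 * h : ℝ) : ℂ) * Complex.I)) / (1 + Complex.exp (((2 * h : ℝ) : ℂ) * Complex.I)) = -(((Real.tan h : ℝ) : ℂ) * Complex.I) := by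
  have hC : ((Real.cos h : ℝ) : ℂ) ≠ 0 := by exact_mod_cast hc
  have hsq : ((Real.cos h : ℝ) : ℂ) ^ 2 + ((Real.sin h : ℝ) : ℂ) ^ 2 = 1 := by
    exact_mod_cast Real.cos_sq_add_sin_sq h
  have he : Complex.exp (((2 * h : ℝ) : ℂ) * Complex.I) = (((Real.cos h : ℝ) : ℂ) + ((Real.sin h : ℝ) : ℂ) * Complex.I) ^ 2 := by
    rw [Complex.ofReal_cos, Complex.ofReal_sin, ← Complex.exp_mul_I, ← Complex.exp_nat_mul]
    congr 1; push_cast; ring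
  have h0 : ((Real.cos h : ℝ) : ℂ) + ((Real.sin h : ℝ) : ℂ) * Complex.I ≠ 0 := by
    intro hz
    rw [hz] at he
    exact Complex.exp_ne_zero _ (by rw [he]; simp)
  have hp : 1 + Complex.exp (((2 * h : ℝ) : ℂ) * Complex.I) = 2 * ((Real.cos h : ℝ) : ℂ) * (((Real.cos h : ℝ) : ℂ) + ((Real.sin h : ℝ) : ℂ) * Complex.I) := by
    rw [he]
    linear_combination -hsq + ((Real.sin h : ℝ) : ℂ) ^ 2 * Complex.I_sq
  have hm : 1 - Complex.exp (((2 * h : ℝ) : ℂ) * Complex.I) = -2 * Complex.I * ((Real.sin h : ℝ) : ℂ) * (((Real.cos h : ℝ) : ℂ) + ((Real.sin h : ℝ) : ℂ) * Complex.I) := by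
    rw [he]
    linear_combination -hsq + ((Real.sin h : ℝ) : ℂ) ^ 2 * Complex.I_sq
  rw [hp, hm]
  refine ⟨mul_ne_zero (mul_ne_zero two_ne_zero hC) h0, ?_⟩
  rw [Real.tan_eq_sin_div_cos]
  rw [div_eq_iff (mul_ne_zero (mul_ne_zero two_ne_zero hC) h0), Complex.ofReal_div]
  generalize ((Real.cos h : ℝ) : ℂ) = C at *
  generalize ((Real.sin h : ℝ) : ℂ) = S at *
  field_simp

open Classical in
noncomputable def Gdisk (ν t μ : ℝ) (w : ℂ) : ℂ :=
  if w = -1 then 0 else Complex.exp (-(t * ((μ : ℂ) * ((1 - w) / (1 + w))) ^ (ν : ℂ)))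

lemma one_add_ne {w : ℂ} (h : w ≠ -1) : 1 + w ≠ 0 := fun h' => h (by linear_combination h')

lemma re_cayley (w : ℂ) : ((1 - w) / (1 + w)).re = (1 - ‖w‖ ^ 2) / Complex.normSq (1 + w) := by
  rw [Complex.div_re, ← Complex.normSq_eq_norm_sq, Complex.normSq_apply w]
  simp
  ring

lemma re_cpow_ge (ν : ℝ) (hν : ν ∈ Ioo (0:ℝ) 1) (z : ℂ) (hz : 0 ≤ z.re) (hz0 : z ≠ 0) :
    Real.cos (Real.pi * ν / 2) * ‖z‖ ^ ν ≤ (z ^ (ν : ℂ)).re := by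
  have hpi := Real.pi_pos
  have hn : 0 < ‖z‖ := norm_pos_iff.2 hz0
  have harg := Complex.abs_arg_le_pi_div_two_iff.2 hz
  rw [Complex.cpow_def_of_ne_zero hz0, Complex.exp_re, Complex.re_mul_ofReal, Complex.im_mul_ofReal, Complex.log_re, Complex.log_im,
    Real.rpow_def_of_pos hn, mul_comm]
  refine mul_le_mul_of_nonneg_left ?_ (Real.exp_pos _).le
  rw [← Real.cos_abs (_ * ν)]
  refine Real.cos_le_cos_of_nonneg_of_le_pi (abs_nonneg _) ?_ ?_
  · nlinarith [hν.2]
  · rw [abs_mul, abs_of_pos hν.1]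
    nlinarith [hν.1]

lemma Gdisk_cont (ν : ℝ) (hν : ν ∈ Ioo (0:ℝ) 1) (t : ℝ) (ht : 0 < t) (μ : ℝ) (hμ : 0 < μ) :
    ContinuousOn (Gdisk ν t μ) (Metric.closedBall 0 1) := by
  have hre : ∀ w ∈ Metric.closedBall (0:ℂ) 1, 0 ≤ ((μ : ℂ) * ((1 - w) / (1 + w))).re := by
    intro w hw
    rw [Complex.re_ofReal_mul, re_cayley]
    have : ‖w‖ ≤ 1 := by simpa using hw
    refine mul_nonneg hμ.le (div_nonneg ?_ (Complex.normSq_nonneg _))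
    nlinarith [norm_nonneg w]
  intro w hw
  by_cases h1 : w = -1
  · subst h1
    rw [← continuousWithinAt_sdiff_self, ContinuousWithinAt]
    rw [show Gdisk ν t μ (-1) = 0 by simp [Gdisk]]
    rw [tendsto_zero_iff_norm_tendsto_zero]
    have hinf : Filter.Tendsto (fun w : ℂ => ‖(μ : ℂ) * ((1 - w) / (1 + w))‖) (nhdsWithin (-1) (Metric.closedBall 0 1 \ {-1})) Filter.atTop := by
      have h2 : Filter.Tendsto (fun w : ℂ => 1 + w) (nhdsWithin (-1) (Metric.closedBall 0 1 \ {-1})) (nhdsWithin 0 {0}ᶜ) := by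
        refine tendsto_nhdsWithin_iff.2 ⟨?_, ?_⟩
        · have : ContinuousAt (fun w : ℂ => 1 + w) (-1) := by fun_prop
          have h3 := this.tendsto.mono_left (nhdsWithin_le_nhds (s := Metric.closedBall 0 1 \ {-1}))
          simpa using h3
        · filter_upwards [self_mem_nhdsWithin] with w hw
          exact one_add_ne hw.2
      have h4 := (tendsto_norm_inv_nhdsNE_zero_atTop (α := ℂ)).comp h2
      have h5 : Filter.Tendsto (fun w : ℂ => μ * ‖1 - w‖) (nhdsWithin (-1) (Metric.closedBall 0 1 \ {-1})) (nhds (μ * 2)) := by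
        have : ContinuousAt (fun w : ℂ => μ * ‖1 - w‖) (-1) := by fun_prop
        have h3 := this.tendsto.mono_left (nhdsWithin_le_nhds (s := Metric.closedBall 0 1 \ {-1}))
        convert h3 using 3
        norm_num
      refine (h5.pos_mul_atTop (by positivity) h4).congr fun w => ?_
      simp [abs_of_pos hμ, div_eq_mul_inv, mul_assoc]
    have hlim : Filter.Tendsto (fun w : ℂ => Real.exp (-(t * (Real.cos (Real.pi * ν / 2) * ‖(μ : ℂ) * ((1 - w) / (1 + w))‖ ^ ν))))
        (nhdsWithin (-1) (Metric.closedBall 0 1 \ {-1})) (nhds 0) := by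
      refine Real.tendsto_exp_neg_atTop_nhds_zero.comp ?_
      refine Filter.Tendsto.const_mul_atTop ht (Filter.Tendsto.const_mul_atTop (cos_pos_aux ν hν) ?_)
      exact (tendsto_rpow_atTop hν.1).comp hinf
    refine squeeze_zero' (Filter.Eventually.of_forall fun _ => norm_nonneg _) ?_ hlim
    filter_upwards [self_mem_nhdsWithin, hinf.eventually_gt_atTop 0] with w hw hpos
    have hw1 : w ≠ -1 := hw.2
    rw [Gdisk, if_neg hw1, Complex.norm_exp, Complex.neg_re, Complex.re_ofReal_mul, Real.exp_le_exp, neg_le_neg_iff]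
    refine mul_le_mul_of_nonneg_left ?_ ht.le
    exact re_cpow_ge ν hν _ (hre w hw.1) (norm_pos_iff.1 hpos)
  · refine ContinuousAt.continuousWithinAt ?_
    have hne : ∀ᶠ w' in nhds w, Gdisk ν t μ w' = Complex.exp (-(t * ((μ : ℂ) * ((1 - w') / (1 + w'))) ^ (ν : ℂ))) := by
      filter_upwards [isOpen_ne.mem_nhds h1] with w' hw'
      rw [Gdisk, if_neg hw']
    refine ContinuousAt.congr ?_ (hne.mono fun _ h => h.symm)
    have hz : ContinuousAt (fun w : ℂ => (μ : ℂ) * ((1 - w) / (1 + w))) w :=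
      ContinuousAt.mul continuousAt_const (ContinuousAt.div (by fun_prop) (by fun_prop) (one_add_ne h1))
    have hcp := (Complex.continuousAt_cpow_const_of_re_pos (z := (μ : ℂ) * ((1 - w) / (1 + w))) (w := (ν:ℂ)) (Or.inl (hre w hw)) (by simpa using hν.1))
    have := ContinuousAt.comp (f := fun w : ℂ => (μ : ℂ) * ((1 - w) / (1 + w))) (x := w) hcp hz
    exact (continuousAt_const.mul this).neg.cexp

lemma Gdisk_diff (ν t μ : ℝ) (hμ : 0 < μ) (w : ℂ) (hw : w ∈ Metric.ball (0:ℂ) 1) :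
    DifferentiableAt ℂ (Gdisk ν t μ) w := by
  have hw1 : ‖w‖ < 1 := by simpa using hw
  have h1 : w ≠ -1 := by rintro rfl; simp at hw1
  have hne : ∀ᶠ w' in nhds w, Gdisk ν t μ w' = Complex.exp (-(t * ((μ : ℂ) * ((1 - w') / (1 + w'))) ^ (ν : ℂ))) := by
    filter_upwards [isOpen_ne.mem_nhds h1] with w' hw'
    rw [Gdisk, if_neg hw']
  refine DifferentiableAt.congr_of_eventuallyEq ?_ hne
  have hz : DifferentiableAt ℂ (fun w : ℂ => (μ : ℂ) * ((1 - w) / (1 + w))) w :=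
    (DifferentiableAt.div (by fun_prop) (by fun_prop) (one_add_ne h1)).const_mul _
  have hs : (μ : ℂ) * ((1 - w) / (1 + w)) ∈ Complex.slitPlane := by
    rw [Complex.mem_slitPlane_iff]
    left
    rw [Complex.re_ofReal_mul, re_cayley]
    refine mul_pos hμ (div_pos ?_ (Complex.normSq_pos.2 (one_add_ne h1)))
    nlinarith [norm_nonneg w]
  exact (((hz.cpow (differentiableAt_const _) hs).const_mul _).neg).cexp

lemma Gdisk_zero (ν t μ : ℝ) (hμ : 0 < μ) : Gdisk ν t μ 0 = ((Real.exp (-(μ ^ ν) * t) : ℝ) : ℂ) := by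
  rw [Gdisk, if_neg (by norm_num), Complex.ofReal_exp]
  push_cast
  rw [Complex.ofReal_cpow hμ.le]
  congr 1
  simp
  ring

lemma Gdisk_circle (ν t μ : ℝ) (hμ : 0 < μ) (θ : ℝ) (hθ : θ ∈ Ioo 0 Real.pi) :
    Gdisk ν t μ (circleMap 0 1 θ) + Gdisk ν t μ (circleMap 0 1 (2 * Real.pi - θ)) =
      ((2 * (phi ν t (μ * Real.tan (θ / 2))).re : ℝ) : ℂ) := by
  have hpi := Real.pi_pos
  have hc : 0 < Real.cos (θ / 2) := Real.cos_pos_of_mem_Ioo ⟨by linarith [hθ.1], by linarith [hθ.2]⟩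
  have htan : 0 < Real.tan (θ / 2) := Real.tan_pos_of_pos_of_lt_pi_div_two (by linarith [hθ.1]) (by linarith [hθ.2])
  have hy : 0 < μ * Real.tan (θ / 2) := mul_pos hμ htan
  obtain ⟨a1, a2⟩ := exp_two_aux (θ / 2) hc.ne'
  obtain ⟨b1, b2⟩ := exp_two_aux (Real.pi - θ / 2) (by rw [Real.cos_pi_sub]; linarith)
  rw [show 2 * (θ / 2) = θ by ring] at a1 a2
  rw [show 2 * (Real.pi - θ / 2) = 2 * Real.pi - θ by ring] at b1 b2
  have hm1 : ∀ w : ℂ, 1 + w ≠ 0 → w ≠ -1 := by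
    rintro w hw rfl
    simp at hw
  rw [circleMap_zero, circleMap_zero, Complex.ofReal_one, one_mul, one_mul, Gdisk, Gdisk, if_neg (hm1 _ a1), if_neg (hm1 _ b1), a2, b2,
    Real.tan_pi_sub]
  rw [show (μ : ℂ) * -((Real.tan (θ / 2) : ℝ) * Complex.I) = ((μ * Real.tan (θ / 2) : ℝ) : ℂ) * (-Complex.I) by push_cast; ring,
    show (μ : ℂ) * -((-Real.tan (θ / 2) : ℝ) * Complex.I) = ((μ * Real.tan (θ / 2) : ℝ) : ℂ) * Complex.I by push_cast; ring,
    I_cpow_aux _ hy, neg_I_cpow_aux _ hy]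
  have h1 : Complex.exp (-((t:ℂ) * ((((μ * Real.tan (θ / 2)) ^ ν : ℝ) : ℂ) * Complex.exp ((Real.pi * ν / 2 : ℝ) * Complex.I)))) = phi ν t (μ * Real.tan (θ / 2)) := by
    rw [phi, cph, mul_assoc]
  have h2 : Complex.exp (-((t:ℂ) * ((((μ * Real.tan (θ / 2)) ^ ν : ℝ) : ℂ) * Complex.exp ((-(Real.pi * ν / 2) : ℝ) * Complex.I)))) = (starRingEnd ℂ) (phi ν t (μ * Real.tan (θ / 2))) := by
    rw [phi, cph, mul_assoc, ← Complex.exp_conj, map_neg, map_mul, map_mul, Complex.conj_ofReal, Complex.conj_ofReal, ← Complex.exp_conj,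
      map_mul, Complex.conj_ofReal, Complex.conj_I]
    congr 5
    push_cast; ring
  rw [h1, h2, add_comm, Complex.add_conj]

lemma poisson_aux (ν : ℝ) (hν : ν ∈ Ioo (0:ℝ) 1) (t : ℝ) (ht : 0 < t) (μ : ℝ) (hμ : 0 < μ) :
    Real.pi⁻¹ * ∫ θ in Ioo 0 Real.pi, (phi ν t (μ * Real.tan (θ / 2))).re = Real.exp (-(μ ^ ν) * t) := by
  have hpi := Real.pi_pos
  have hcont := Gdisk_cont ν hν t ht μ hμ
  have hav := circleAverage_of_differentiable_on_off_countable (f := Gdisk ν t μ) (c := 0) (R := 1) (s := ∅) countable_empty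
    (by simpa using hcont) (by intro z hz; exact Gdisk_diff ν t μ hμ z (by simpa using hz))
  rw [Gdisk_zero ν t μ hμ, Real.circleAverage_def] at hav
  have hc : Continuous fun θ => Gdisk ν t μ (circleMap 0 1 θ) := by
    refine hcont.comp_continuous (continuous_circleMap 0 1) fun θ => ?_
    simp
  have hc2 : Continuous fun θ => Gdisk ν t μ (circleMap 0 1 (2 * Real.pi - θ)) :=
    hc.comp (continuous_const.sub continuous_id)
  rw [← intervalIntegral.integral_add_adjacent_intervals (b := Real.pi) (hc.intervalIntegrable _ _) (hc.intervalIntegrable _ _)] at hav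
  have hsub := intervalIntegral.integral_comp_sub_left (fun θ => Gdisk ν t μ (circleMap 0 1 θ)) (2 * Real.pi) (a := 0) (b := Real.pi)
  rw [sub_zero, show 2 * Real.pi - Real.pi = Real.pi by ring] at hsub
  rw [← hsub, ← intervalIntegral.integral_add (hc.intervalIntegrable _ _) (hc2.intervalIntegrable _ _),
    intervalIntegral.integral_of_le hpi.le, integral_Ioc_eq_integral_Ioo,
    setIntegral_congr_fun measurableSet_Ioo (fun θ hθ => Gdisk_circle ν t μ hμ θ hθ), integral_complex_ofReal, integral_const_mul] at hav
  rw [Complex.real_smul] at hav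
  have hav2 : (2 * Real.pi)⁻¹ * (2 * ∫ θ in Ioo 0 Real.pi, (phi ν t (μ * Real.tan (θ / 2))).re) = Real.exp (-(μ ^ ν) * t) := by
    exact_mod_cast hav
  rw [← hav2]
  field_simp

lemma cov_aux (ν t μ : ℝ) (hμ : 0 < μ) :
    ∫ θ in Ioo 0 Real.pi, (phi ν t (μ * Real.tan (θ / 2))).re = 2 * ∫ y in Ioi (0:ℝ), (μ / (μ ^ 2 + y ^ 2)) * (phi ν t y).re := by
  have himg : (fun y : ℝ => 2 * Real.arctan (y / μ)) '' Ioi 0 = Ioo 0 Real.pi := by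
    ext θ
    constructor
    · rintro ⟨y, hy, rfl⟩
      have hy' : 0 < y := hy
      have h1 : 0 < Real.arctan (y / μ) := Real.arctan_pos.2 (by positivity)
      have h2 := Real.arctan_lt_pi_div_two (y / μ)
      constructor
      · simp only; linarith
      · simp only; linarith
    · intro hθ
      have htan : 0 < Real.tan (θ / 2) := Real.tan_pos_of_pos_of_lt_pi_div_two (by linarith [hθ.1]) (by linarith [hθ.2])
      refine ⟨μ * Real.tan (θ / 2), mul_pos hμ htan, ?_⟩
      simp only
      rw [mul_div_cancel_left₀ _ hμ.ne', Real.arctan_tan (by linarith [hθ.1, Real.pi_pos]) (by linarith [hθ.2])]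
      ring
  have hder : ∀ y ∈ Ioi (0:ℝ), HasDerivWithinAt (fun y : ℝ => 2 * Real.arctan (y / μ)) (2 * (μ / (μ ^ 2 + y ^ 2))) (Ioi 0) y := by
    intro y hy
    have h := (((hasDerivAt_id y).div_const μ).arctan.const_mul 2).hasDerivWithinAt (s := Ioi 0)
    have hpos : 0 < μ ^ 2 + y ^ 2 := by positivity
    have e : 2 * (1 / (1 + (id y / μ) ^ 2) * (1 / μ)) = 2 * (μ / (μ ^ 2 + y ^ 2)) := by
      simp only [id]; field_simp
    rw [e] at h
    exact h
  have hinj : InjOn (fun y : ℝ => 2 * Real.arctan (y / μ)) (Ioi 0) := by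
    intro a _ b _ hab
    have h1 : Real.arctan (a / μ) = Real.arctan (b / μ) := by simpa using hab
    have h2 := Real.arctan_injective h1
    field_simp at h2
    exact h2
  rw [← himg, integral_image_eq_integral_abs_deriv_smul measurableSet_Ioi hder hinj, ← integral_const_mul]
  refine setIntegral_congr_fun measurableSet_Ioi fun y hy => ?_
  simp only [smul_eq_mul]
  rw [abs_of_nonneg (by positivity), mul_div_cancel_left₀ _ (two_ne_zero), Real.tan_arctan, mul_div_cancel₀ _ hμ.ne']
  ring

lemma laplace_pos (ν : ℝ) (hν : ν ∈ Ioo (0:ℝ) 1) (t : ℝ) (ht : 0 < t) (μ : ℝ) (hμ : 0 < μ) :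
    ∫ x in Ioi (0:ℝ), Real.exp (-μ * x) * gfun ν t x = Real.pi / 2 * Real.exp (-(μ ^ ν) * t) := by
  have hpi := Real.pi_pos
  rw [laplace_gfun ν hν t ht μ hμ, ← poisson_aux ν hν t ht μ hμ, cov_aux ν t μ hμ]
  field_simp

lemma laplace_nonneg (ν : ℝ) (hν : ν ∈ Ioo (0:ℝ) 1) (t : ℝ) (ht : 0 < t) (μ : ℝ) (hμ : 0 ≤ μ) :
    ∫ x in Ioi (0:ℝ), Real.exp (-μ * x) * gfun ν t x = Real.pi / 2 * Real.exp (-(μ ^ ν) * t) := by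
  rcases hμ.lt_or_eq with h | rfl
  · exact laplace_pos ν hν t ht μ h
  have L1 : Filter.Tendsto (fun ε : ℝ => ∫ x in Ioi (0:ℝ), Real.exp (-ε * x) * gfun ν t x) (nhdsWithin 0 (Ioi 0))
      (nhds (∫ x in Ioi (0:ℝ), Real.exp (-0 * x) * gfun ν t x)) := by
    have hc := continuous_gfun ν hν t ht
    refine tendsto_integral_filter_of_dominated_convergence (fun x => ‖gfun ν t x‖) ?_ ?_ (integrable_gfun ν hν t ht).norm ?_
    · filter_upwards with ε
      exact Continuous.aestronglyMeasurable (by fun_prop)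
    · filter_upwards [self_mem_nhdsWithin] with ε hε
      refine (ae_restrict_iff' measurableSet_Ioi).2 (ae_of_all _ fun y hy => ?_)
      rw [norm_mul]
      refine mul_le_of_le_one_left (norm_nonneg _) ?_
      rw [Real.norm_of_nonneg (Real.exp_pos _).le, Real.exp_le_one_iff]
      have := mul_nonneg (le_of_lt (mem_Ioi.1 hε)) (le_of_lt (mem_Ioi.1 hy))
      linarith
    · refine ae_of_all _ fun x => ?_
      have : ContinuousAt (fun ε : ℝ => Real.exp (-ε * x) * gfun ν t x) 0 := by fun_prop
      exact this.tendsto.mono_left nhdsWithin_le_nhds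
  have L2 : Filter.Tendsto (fun ε : ℝ => Real.pi / 2 * Real.exp (-(ε ^ ν) * t)) (nhdsWithin 0 (Ioi 0))
      (nhds (Real.pi / 2 * Real.exp (-((0:ℝ) ^ ν) * t))) := by
    have hr : Continuous fun ε : ℝ => ε ^ ν := Real.continuous_rpow_const hν.1.le
    have : Continuous (fun ε : ℝ => Real.pi / 2 * Real.exp (-(ε ^ ν) * t)) := by fun_prop
    exact (this.tendsto 0).mono_left nhdsWithin_le_nhds
  refine tendsto_nhds_unique L1 (L2.congr' ?_)
  filter_upwards [self_mem_nhdsWithin] with ε hε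
  exact (laplace_pos ν hν t ht ε hε).symm

theorem stable_density_eq_scaled_inverse_density
    (ν : ℝ) (hν : ν ∈ Ioo (0:ℝ) 1) :
    ∀ t : ℝ, 0 < t → ∀ μ : ℝ, 0 ≤ μ →
      ∫ x in Ioi (0:ℝ), Real.exp (-μ * x) *
          ((ν * t / x) * (x ^ (-ν) * wrightFn (-ν) (1 - ν) (-(t * x ^ (-ν))))) =
        Real.exp (-(μ ^ ν) * t) := by
  intro t ht μ hμ
  have hpi := Real.pi_pos
  have e : ∀ x ∈ Ioi (0:ℝ), Real.exp (-μ * x) * ((ν * t / x) * (x ^ (-ν) * wrightFn (-ν) (1 - ν) (-(t * x ^ (-ν))))) =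
      2 / Real.pi * (Real.exp (-μ * x) * gfun ν t x) := by
    intro x hx
    rw [density_eq ν hν t ht x hx]
    ring
  rw [setIntegral_congr_fun measurableSet_Ioi e, integral_const_mul, laplace_nonneg ν hν t ht μ hμ]
  field_simp
end
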